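/- For all integers n ≥ 2, L⁺(n) < p̄(n)^{2/(n(n−1)(n+1))} < U⁺(n), where U⁺(n) = 1 + 2π/n^{5/2} − 2·log(8n)/n³ − 2/(π·n^{7/2}) − 1/(π²·n⁴) + (6π⁴ − 2)/(3π³·n^{9/2}) + 140/n⁵ and L⁺(n) = 1 + 2π/n^{5/2} − 2·log(8n)/n³ − 2/(π·n^{7/2}) − 1/(π²·n⁴) + (6π⁴ − 2)/(3π³·n^{9/2}) − 80·(log n)/n⁵. -/

import Mathlib

open Real

/-- The overpartition function. -/
noncomputable def pbar (n : ℕ) : ℕ :=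
  ∑ k ∈ Finset.range (n + 1),
    (Nat.Partition.distincts k).card * Fintype.card (Nat.Partition (n - k))

noncomputable def Uplus (n : ℕ) : ℝ :=
  1 + 2 * π / (n : ℝ) ^ ((5 : ℝ) / 2) - 2 * Real.log (8 * n) / (n : ℝ) ^ 3
    - 2 / (π * (n : ℝ) ^ ((7 : ℝ) / 2)) - 1 / (π ^ 2 * (n : ℝ) ^ 4)
    + (6 * π ^ 4 - 2) / (3 * π ^ 3 * (n : ℝ) ^ ((9 : ℝ) / 2)) + 140 / (n : ℝ) ^ 5

noncomputable def Lplus (n : ℕ) : ℝ :=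
  1 + 2 * π / (n : ℝ) ^ ((5 : ℝ) / 2) - 2 * Real.log (8 * n) / (n : ℝ) ^ 3
    - 2 / (π * (n : ℝ) ^ ((7 : ℝ) / 2)) - 1 / (π ^ 2 * (n : ℝ) ^ 4)
    + (6 * π ^ 4 - 2) / (3 * π ^ 3 * (n : ℝ) ^ ((9 : ℝ) / 2)) - 80 * Real.log n / (n : ℝ) ^ 5

section Helpers

open Filter Topology Finset

section GeneratingFunction

open PowerSeries PowerSeries.WithPiTopology

/-- The power series `(1 + X ^ k) / (1 - X ^ k)`. -/
noncomputable def overFactor (k : ℕ) : ℕ⟦X⟧ :=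
  PowerSeries.mk fun n ↦ if n = 0 then 1 else if k ∣ n then 2 else 0

/-- The generating function of overpartitions into parts of size at most `N`. -/
noncomputable def overTrunc (N : ℕ) : ℕ⟦X⟧ := ∏ k ∈ range N, overFactor (k + 1)

lemma tsum_X_pow_mul_one_add {k : ℕ} (hk : 0 < k) :
    (∑' j : ℕ, (X : ℕ⟦X⟧) ^ (k * j)) * (∑ j ∈ range 2, X ^ (k * j)) = overFactor k := by
  have hs : Summable fun j : ℕ ↦ (X : ℕ⟦X⟧) ^ (k * j) := by
    simp_rw [pow_mul]
    exact summable_pow_of_constantCoeff_eq_zero (by simp [hk.ne'])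
  have hc : (∑' j : ℕ, (X : ℕ⟦X⟧) ^ (k * j)) = PowerSeries.mk fun n ↦ if k ∣ n then 1 else 0 := by
    ext n
    have := hs.hasSum.map (coeff n) (continuous_coeff ℕ n)
    rw [← this.tsum_eq, coeff_mk]
    simp only [Function.comp_def, coeff_X_pow]
    split_ifs with h
    · obtain ⟨m, rfl⟩ := h
      rw [tsum_eq_single m]
      · simp
      · intro j hj
        simp [hk.ne', hj.symm]
    · have : ∀ j, n ≠ k * j := fun j hj ↦ h ⟨j, hj⟩
      simp [this]
  rw [hc]
  ext n
  simp only [sum_range_succ, range_zero, sum_empty, mul_zero, pow_zero, zero_add, mul_one, mul_add,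
    map_add, coeff_mk, coeff_mul_X_pow', overFactor]
  by_cases h0 : n = 0
  · subst h0; simp [hk.ne']
  by_cases h : k ∣ n
  · have h1 : k ≤ n := Nat.le_of_dvd (Nat.pos_of_ne_zero h0) h
    simp [h0, h, h1, Nat.dvd_sub h dvd_rfl]
  · have : k ≤ n → ¬ k ∣ n - k := fun h1 h2 ↦ by
      rw [Nat.dvd_sub_self_right] at h2
      rcases h2 with h2 | h2
      · exact h h2
      · exact h (le_antisymm h1 h2 ▸ dvd_rfl)
    simp only [h0, h, if_false, zero_add, ite_eq_right_iff]
    intro h1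
    have h2 := this h1
    have h3 : n - k ≠ 0 := fun h3 ↦ h2 (h3 ▸ dvd_zero k)
    simp [h2]

lemma hasProd_overFactor : HasProd (fun i ↦ overFactor (i + 1)) (PowerSeries.mk pbar) := by
  have h1 := Nat.Partition.hasProd_powerSeriesMk_card_restricted ℕ (fun _ ↦ True)
  have h2 := Nat.Partition.hasProd_powerSeriesMk_card_countRestricted ℕ (m := 2) two_pos
  have h := h1.mul h2
  simp only [if_true, tsum_X_pow_mul_one_add (Nat.succ_pos _)] at h
  convert h using 1
  ext n
  rw [mul_comm, coeff_mul, Nat.sum_antidiagonal_eq_sum_range_succ_mk]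
  simp [pbar, Nat.Partition.countRestricted_two, Nat.Partition.restricted]

lemma eventually_coeff_overTrunc (n : ℕ) :
    ∀ᶠ N in atTop, coeff n (overTrunc N) = pbar n := by
  have h := hasProd_overFactor.tendsto_prod_nat
  rw [tendsto_iff_coeff_tendsto] at h
  have := h n
  rw [coeff_mk] at this
  rwa [nhds_discrete, tendsto_pure] at this

lemma monotone_coeff_overTrunc (n : ℕ) : Monotone fun N ↦ coeff n (overTrunc N) := by
  refine monotone_nat_of_le_succ fun N ↦ ?_
  rw [overTrunc, overTrunc, prod_range_succ, coeff_mul]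
  refine le_trans ?_ (single_le_sum (f := fun p : ℕ × ℕ ↦ coeff p.1 (∏ k ∈ range N,
    overFactor (k + 1)) * coeff p.2 (overFactor (N + 1))) (fun _ _ ↦ Nat.zero_le _)
    (show (n, 0) ∈ antidiagonal n by simp))
  simp [overFactor]

lemma coeff_overTrunc_le (N n : ℕ) : coeff n (overTrunc N) ≤ pbar n := by
  obtain ⟨M, hM, hN⟩ := ((eventually_coeff_overTrunc n).and (eventually_ge_atTop N)).exists
  exact hM ▸ monotone_coeff_overTrunc n hN

lemma hasSum_overFactor {k : ℕ} (hk : 0 < k) {q : ℂ} (hq : ‖q‖ < 1) :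
    HasSum (fun n ↦ ((coeff n (overFactor k) : ℕ) : ℂ) * q ^ n) ((1 + q ^ k) / (1 - q ^ k)) := by
  have hx : ‖q ^ k‖ < 1 := by
    rw [norm_pow]; exact pow_lt_one₀ (norm_nonneg _) hq hk.ne'
  have h1 : 1 - q ^ k ≠ 0 := by
    intro h
    rw [← sub_eq_zero.1 h] at hx
    simp at hx
  have hinj : Function.Injective fun j : ℕ ↦ k * j := fun a b h ↦ Nat.eq_of_mul_eq_mul_left hk h
  rw [← hinj.hasSum_iff]
  · have h2 := ((hasSum_geometric_of_norm_lt_one hx).mul_left 2).sub (hasSum_ite_eq 0 (1 : ℂ))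
    have e1 : (1 + q ^ k) / (1 - q ^ k) = 2 * (1 - q ^ k)⁻¹ - 1 := by
      field_simp
      ring
    rw [e1]
    refine h2.congr_fun fun j ↦ ?_
    rcases Nat.eq_zero_or_pos j with rfl | hj
    · simp [overFactor]
      norm_num
    · simp [overFactor, hj.ne', hk.ne', pow_mul]
  · intro n hn
    have h3 : ¬ k ∣ n := fun ⟨m, hm⟩ ↦ hn ⟨m, hm.symm⟩
    have h4 : n ≠ 0 := fun h ↦ h3 (h ▸ dvd_zero k)
    simp [overFactor, h3, h4]

lemma summable_norm_overFactor {k : ℕ} (hk : 0 < k) {q : ℂ} (hq : ‖q‖ < 1) :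
    Summable fun n ↦ ‖((coeff n (overFactor k) : ℕ) : ℂ) * q ^ n‖ := by
  have := (hasSum_overFactor hk (q := (‖q‖ : ℂ)) (by simpa using hq)).summable.norm
  simpa using this

lemma hasSum_overTrunc (N : ℕ) {q : ℂ} (hq : ‖q‖ < 1) :
    Summable (fun n ↦ ‖((coeff n (overTrunc N) : ℕ) : ℂ) * q ^ n‖) ∧
    HasSum (fun n ↦ ((coeff n (overTrunc N) : ℕ) : ℂ) * q ^ n)
      (∏ k ∈ range N, (1 + q ^ (k + 1)) / (1 - q ^ (k + 1))) := by
  induction N with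
  | zero =>
    have h : ∀ n, ((coeff n (overTrunc 0) : ℕ) : ℂ) * q ^ n = if n = 0 then 1 else 0 := by
      intro n
      by_cases h : n = 0 <;> simp [overTrunc, coeff_one, h]
    simp only [h, range_zero, prod_empty]
    refine ⟨?_, hasSum_ite_eq 0 1⟩
    exact (hasSum_ite_eq 0 (1 : ℂ)).summable.norm
  | succ N ih =>
    have hf := summable_norm_overFactor N.succ_pos hq
    have h1 : ∀ n, ((coeff n (overTrunc (N + 1)) : ℕ) : ℂ) * q ^ n =
        ∑ p ∈ antidiagonal n, ((coeff p.1 (overTrunc N) : ℕ) * q ^ p.1) *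
          ((coeff p.2 (overFactor (N + 1)) : ℕ) * q ^ p.2) := by
      intro n
      rw [overTrunc, prod_range_succ, ← overTrunc, coeff_mul, Nat.cast_sum, sum_mul]
      refine sum_congr rfl fun p hp ↦ ?_
      rw [← mem_antidiagonal.1 hp]
      push_cast
      ring
    simp only [h1]
    have h2 := summable_norm_sum_mul_antidiagonal_of_summable_norm ih.1 hf
    refine ⟨h2, ?_⟩
    rw [prod_range_succ, ← ih.2.tsum_eq, ← (hasSum_overFactor N.succ_pos hq).tsum_eq,
      tsum_mul_tsum_eq_tsum_sum_antidiagonal_of_summable_norm ih.1 hf]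
    exact h2.of_norm.hasSum

lemma prod_overFactor_le {r : ℝ} (h0 : 0 ≤ r) (h1 : r < 1) (N : ℕ) :
    ∏ k ∈ range N, (1 + r ^ (k + 1)) / (1 - r ^ (k + 1)) ≤ Real.exp (2 / (1 - r) * (1 - r)⁻¹) := by
  have hr : 0 < 1 - r := by linarith
  calc _ ≤ ∏ k ∈ range N, Real.exp (2 / (1 - r) * r ^ k) := by
        have hpos : ∀ k : ℕ, 1 - r ≤ 1 - r ^ (k + 1) := fun k ↦ by
          have := pow_le_of_le_one h0 h1.le (n := k + 1) (by simp)
          linarith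
        refine prod_le_prod (fun k _ ↦ ?_) (fun k _ ↦ ?_)
        · have := hpos k
          have := pow_nonneg h0 (k + 1)
          exact div_nonneg (by linarith) (by linarith)
        · have h2 := hpos k
          have h3 : (1 + r ^ (k + 1)) / (1 - r ^ (k + 1)) = 2 * r ^ (k + 1) / (1 - r ^ (k + 1)) + 1 := by
            have : 1 - r ^ (k + 1) ≠ 0 := by linarith
            field_simp; ring
          rw [h3]
          refine le_trans ?_ (Real.add_one_le_exp _)
          gcongr ?_ + 1
          rw [div_mul_eq_mul_div]
          gcongr 2 * ?_ / ?_
          exact pow_le_pow_of_le_one h0 h1.le (Nat.le_succ k)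
    _ = Real.exp (2 / (1 - r) * ∑ k ∈ range N, r ^ k) := by
        rw [← Real.exp_sum, mul_sum]
    _ ≤ _ := by
        gcongr
        rw [← tsum_geometric_of_lt_one h0 h1]
        exact (summable_geometric_of_lt_one h0 h1).sum_le_tsum _ (fun _ _ ↦ pow_nonneg h0 _)

lemma summable_pbar {r : ℝ} (h0 : 0 ≤ r) (h1 : r < 1) : Summable fun n ↦ (pbar n : ℝ) * r ^ n := by
  refine summable_of_sum_range_le (c := Real.exp (2 / (1 - r) * (1 - r)⁻¹))
    (fun n ↦ by positivity) fun m ↦ ?_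
  have : ∀ᶠ N in atTop, ∀ n ∈ range m, coeff n (overTrunc N) = pbar n :=
    (Finset.eventually_all _).2 fun n _ ↦ eventually_coeff_overTrunc n
  obtain ⟨N, hN⟩ := this.exists
  refine le_trans ?_ (prod_overFactor_le h0 h1 N)
  have h2 := (hasSum_overTrunc N (q := (r : ℂ)) (by simpa [abs_of_nonneg h0] using h1)).2
  have h3 : HasSum (fun n ↦ ((coeff n (overTrunc N) : ℕ) : ℝ) * r ^ n)
      (∏ k ∈ range N, (1 + r ^ (k + 1)) / (1 - r ^ (k + 1))) := by
    rw [← Complex.hasSum_ofReal]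
    push_cast
    exact h2
  rw [← h3.tsum_eq]
  refine le_trans (le_of_eq (sum_congr rfl fun n hn ↦ ?_))
    (h3.summable.sum_le_tsum (range m) fun _ _ ↦ by positivity)
  rw [hN n hn]

/-- The generating function of overpartitions on the unit disc. -/
noncomputable def overGen (q : ℂ) : ℂ := ∑' n, (pbar n : ℂ) * q ^ n

lemma summable_norm_pbar {q : ℂ} (hq : ‖q‖ < 1) : Summable fun n ↦ ‖(pbar n : ℂ) * q ^ n‖ := by
  simpa using summable_pbar (norm_nonneg q) hq

lemma tendsto_prod_overGen {q : ℂ} (hq : ‖q‖ < 1) :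
    Tendsto (fun N ↦ ∏ k ∈ range N, (1 + q ^ (k + 1)) / (1 - q ^ (k + 1))) atTop
      (𝓝 (overGen q)) := by
  simp_rw [← (hasSum_overTrunc _ hq).2.tsum_eq, overGen]
  refine tendsto_tsum_of_dominated_convergence (summable_norm_pbar hq) (fun n ↦ ?_)
    (Eventually.of_forall fun N n ↦ ?_)
  · refine tendsto_const_nhds.congr' ?_
    filter_upwards [eventually_coeff_overTrunc n] with N hN
    rw [hN]
  · simp only [norm_mul, Complex.norm_natCast]
    gcongr
    exact coeff_overTrunc_le N n

end GeneratingFunction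

section Gauss

lemma one_sub_pow_ne_zero_of_norm_lt_one {q : ℂ} (hq : ‖q‖ < 1) (k : ℕ) :
    1 - q ^ (k + 1) ≠ 0 := by
  intro h
  have h1 := pow_lt_one₀ (norm_nonneg q) hq k.succ_ne_zero
  rw [← norm_pow, Nat.succ_eq_add_one, ← sub_eq_zero.1 h] at h1
  simp at h1

lemma one_add_pow_ne_zero_of_norm_lt_one {q : ℂ} (hq : ‖q‖ < 1) (k : ℕ) : 1 + q ^ k ≠ 0 := by
  rcases Nat.eq_zero_or_pos k with rfl | hk
  · norm_num
  intro h
  have h1 := pow_lt_one₀ (norm_nonneg q) hq hk.ne'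
  rw [← norm_pow, eq_neg_of_add_eq_zero_right h] at h1
  simp at h1

/-- The Taylor coefficients of `∑ n : ℤ, (-1) ^ n * q ^ (n ^ 2)`, indexed by the exponent's root. -/
def thetaSign (j : ℕ) : ℤ := if j = 0 then 1 else 2 * (-1) ^ j

lemma gauss_telescope {q : ℂ} (hq : ‖q‖ < 1) (n m : ℕ) :
    ∑ s ∈ range (m + 1), (-1) ^ s * 2 / (1 + q ^ s) *
      (∏ k ∈ range s, (1 + q ^ (k + 1)) / (1 - q ^ (k + 1))) *
      (q ^ (s * (n + 2)) - q ^ (s * (n + 1)) * ((1 + q ^ (n + 1)) / (1 - q ^ (n + 1)))) =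
    (-1) ^ (m + 1) * 2 * q ^ ((m + 1) * (n + 1)) / (1 - q ^ (n + 1)) *
      ∏ k ∈ range m, (1 + q ^ (k + 1)) / (1 - q ^ (k + 1)) := by
  have hx := one_sub_pow_ne_zero_of_norm_lt_one hq n
  induction m with
  | zero =>
    simp
    field_simp
    ring
  | succ m ih =>
    have hy := one_sub_pow_ne_zero_of_norm_lt_one hq m
    have hy' := one_add_pow_ne_zero_of_norm_lt_one hq (m + 1)
    rw [sum_range_succ, ih, prod_range_succ]
    have e1 : q ^ ((m + 1) * (n + 2)) = q ^ ((m + 1) * (n + 1)) * q ^ (m + 1) := by ring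
    have e2 : q ^ ((m + 1 + 1) * (n + 1)) = q ^ ((m + 1) * (n + 1)) * q ^ (n + 1) := by ring
    rw [e1, e2]
    generalize q ^ ((m + 1) * (n + 1)) = w
    generalize q ^ (m + 1) = y at *
    generalize q ^ (n + 1) = x at *
    generalize ∏ k ∈ range m, (1 + q ^ (k + 1)) / (1 - q ^ (k + 1)) = A
    field_simp
    ring

lemma gauss_finite {q : ℂ} (hq : ‖q‖ < 1) (n : ℕ) :
    (∏ k ∈ range n, (1 + q ^ (k + 1)) / (1 - q ^ (k + 1))) *
      ∑ j ∈ range (n + 1), (thetaSign j : ℂ) * q ^ (j ^ 2) =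
    ∑ s ∈ range (n + 1), (-1) ^ s * 2 / (1 + q ^ s) *
      (∏ k ∈ range s, (1 + q ^ (k + 1)) / (1 - q ^ (k + 1))) * q ^ (s * (n + 1)) := by
  induction n with
  | zero => norm_num [thetaSign]
  | succ n ih =>
    have hx := one_sub_pow_ne_zero_of_norm_lt_one hq n
    have hx' := one_add_pow_ne_zero_of_norm_lt_one hq (n + 1)
    have ht := gauss_telescope hq n n
    simp only [mul_sub, sum_sub_distrib, ← mul_assoc, ← sum_mul] at ht
    rw [← ih, sub_eq_iff_eq_add] at ht
    rw [sum_range_succ _ (n + 1), sum_range_succ _ (n + 1), mul_add, prod_range_succ]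
    rw [ht, thetaSign, if_neg n.succ_ne_zero]
    have e1 : q ^ ((n + 1) * (n + 1 + 1)) = q ^ ((n + 1) ^ 2) * q ^ (n + 1) := by ring
    have e2 : q ^ ((n + 1) * (n + 1)) = q ^ ((n + 1) ^ 2) := by ring
    rw [e1, e2]
    push_cast
    generalize q ^ ((n + 1) ^ 2) = w
    generalize q ^ (n + 1) = x at *
    generalize ∏ k ∈ range n, (1 + q ^ (k + 1)) / (1 - q ^ (k + 1)) = A
    generalize ∑ j ∈ range (n + 1), (thetaSign j : ℂ) * q ^ (j ^ 2) = S
    field_simp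
    ring

lemma summable_thetaSign {q : ℂ} (hq : ‖q‖ < 1) :
    Summable fun j : ℕ ↦ (thetaSign j : ℂ) * q ^ (j ^ 2) := by
  refine Summable.of_norm_bounded
    ((summable_geometric_of_lt_one (norm_nonneg q) hq).mul_left 2) fun j ↦ ?_
  rw [norm_mul, norm_pow]
  refine mul_le_mul ?_ ?_ (by positivity) zero_le_two
  · unfold thetaSign
    split_ifs <;> simp
  · exact pow_le_pow_of_le_one (norm_nonneg q) hq.le (Nat.le_self_pow two_ne_zero j)

lemma norm_prod_overFactor_le {q : ℂ} (hq : ‖q‖ < 1) (n : ℕ) :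
    ‖∏ k ∈ range n, (1 + q ^ (k + 1)) / (1 - q ^ (k + 1))‖ ≤
      ∏ k ∈ range n, (1 + ‖q‖ ^ (k + 1)) / (1 - ‖q‖ ^ (k + 1)) := by
  rw [norm_prod]
  refine prod_le_prod (fun _ _ ↦ norm_nonneg _) fun k _ ↦ ?_
  have h1 := pow_lt_one₀ (norm_nonneg q) hq k.succ_ne_zero
  rw [norm_div]
  refine div_le_div₀ (by positivity) ?_ (sub_pos.2 h1) ?_
  · exact (norm_add_le _ _).trans (by simp)
  · exact le_trans (by simp) (norm_sub_norm_le _ _)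

/-- Gauss's identity `∏ (1 - q ^ n) / (1 + q ^ n) = ∑ n : ℤ, (-1) ^ n * q ^ (n ^ 2)`. -/
lemma overGen_mul_theta {q : ℂ} (hq : ‖q‖ < 1) :
    overGen q * ∑' j : ℕ, (thetaSign j : ℂ) * q ^ (j ^ 2) = 1 := by
  have h1 := (tendsto_prod_overGen hq).mul
    ((tendsto_add_atTop_iff_nat 1).2 (summable_thetaSign hq).hasSum.tendsto_sum_nat)
  refine tendsto_nhds_unique h1 ?_
  simp_rw [gauss_finite hq]
  rw [tendsto_iff_norm_sub_tendsto_zero]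
  set r := ‖q‖
  have hr : 0 ≤ r := norm_nonneg q
  set B := Real.exp (2 / (1 - r) * (1 - r)⁻¹)
  have hlim : Tendsto (fun n : ℕ ↦ 2 / (1 - r) * B * (n * r ^ n)) atTop (𝓝 0) := by
    simpa using (tendsto_self_mul_const_pow_of_lt_one hr hq).const_mul (2 / (1 - r) * B)
  refine squeeze_zero (fun _ ↦ norm_nonneg _) (fun n ↦ ?_) hlim
  rw [sum_range_succ']
  have e : ((-1 : ℂ) ^ 0 * 2 / (1 + q ^ 0) *
      (∏ k ∈ range 0, (1 + q ^ (k + 1)) / (1 - q ^ (k + 1))) * q ^ (0 * (n + 1))) = 1 := by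
    norm_num
  rw [e, add_sub_cancel_right]
  refine (norm_sum_le_of_le (f := fun s ↦ (-1) ^ (s + 1) * 2 / (1 + q ^ (s + 1)) *
      (∏ k ∈ range (s + 1), (1 + q ^ (k + 1)) / (1 - q ^ (k + 1))) * q ^ ((s + 1) * (n + 1)))
      (range n) (n := fun _ ↦ 2 / (1 - r) * B * r ^ n) fun s _ ↦ ?_).trans ?_
  · rw [norm_mul, norm_mul, norm_div, norm_pow]
    have h2 : 1 - r ≤ ‖1 + q ^ (s + 1)‖ := by
      have h3 : 1 - r ^ (s + 1) ≤ ‖1 + q ^ (s + 1)‖ := by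
        have := norm_sub_norm_le (1 : ℂ) (-q ^ (s + 1))
        simpa using this
      have := pow_le_of_le_one hr hq.le (n := s + 1) (by simp)
      linarith
    have h4 : ‖q ^ (s + 1)‖ ≤ r := by
      rw [norm_pow]
      exact pow_le_of_le_one hr hq.le (n := s + 1) (by simp)
    have h5 : 0 < 1 - r := sub_pos.2 hq
    refine mul_le_mul (mul_le_mul ?_ ?_ (norm_nonneg _) (by positivity)) ?_ (by positivity)
      (by positivity)
    · exact div_le_div₀ zero_le_two (by simp) h5 h2
    · exact (norm_prod_overFactor_le hq _).trans (prod_overFactor_le hr hq _)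
    · exact pow_le_pow_of_le_one hr hq.le (by nlinarith)
  · simp only [sum_const, card_range, nsmul_eq_mul]
    exact le_of_eq (by ring)

/-- The Taylor coefficients of `∑ n : ℤ, (-1) ^ n * q ^ (n ^ 2)`. -/
def thetaCoeff (n : ℕ) : ℤ := if n.sqrt ^ 2 = n then thetaSign n.sqrt else 0

lemma hasSum_thetaCoeff {q : ℂ} (hq : ‖q‖ < 1) :
    HasSum (fun n : ℕ ↦ (thetaCoeff n : ℂ) * q ^ n)
      (∑' j : ℕ, (thetaSign j : ℂ) * q ^ (j ^ 2)) := by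
  have hinj : Function.Injective fun j : ℕ ↦ j ^ 2 := Nat.pow_left_injective two_ne_zero
  rw [← hinj.hasSum_iff]
  · refine (summable_thetaSign hq).hasSum.congr_fun fun j ↦ ?_
    simp [thetaCoeff, Nat.sqrt_eq']
  · intro n hn
    have : n.sqrt ^ 2 ≠ n := fun h ↦ hn ⟨n.sqrt, h⟩
    simp [thetaCoeff, this]

/-- Overpartition numbers satisfy the recurrence coming from Gauss's identity. -/
lemma pbar_recurrence (n : ℕ) :
    ∑ p ∈ antidiagonal n, (pbar p.1 : ℤ) * thetaCoeff p.2 = if n = 0 then 1 else 0 := by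
  have key : ∀ q : ℂ, ‖q‖ < 1 → HasSum (fun n : ℕ ↦ q ^ n •
      ((∑ p ∈ antidiagonal n, (pbar p.1 : ℤ) * thetaCoeff p.2 : ℤ) : ℂ)) 1 := by
    intro q hq
    have hf := summable_norm_pbar hq
    have hg := (hasSum_thetaCoeff hq).summable.norm
    have h1 := (summable_norm_sum_mul_antidiagonal_of_summable_norm hf hg).of_norm.hasSum
    rw [← tsum_mul_tsum_eq_tsum_sum_antidiagonal_of_summable_norm hf hg,
      (hasSum_thetaCoeff hq).tsum_eq, ← overGen, overGen_mul_theta hq] at h1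
    refine h1.congr_fun fun n ↦ ?_
    rw [smul_eq_mul, Int.cast_sum, mul_sum]
    refine sum_congr rfl fun p hp ↦ ?_
    rw [← mem_antidiagonal.1 hp]
    push_cast
    ring
  have h1 : HasFPowerSeriesAt (fun _ : ℂ ↦ (1 : ℂ)) (FormalMultilinearSeries.ofScalars ℂ
      fun n ↦ ((∑ p ∈ antidiagonal n, (pbar p.1 : ℤ) * thetaCoeff p.2 : ℤ) : ℂ)) 0 := by
    rw [hasFPowerSeriesAt_iff]
    filter_upwards [Metric.ball_mem_nhds (0 : ℂ) one_pos] with q hq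
    simpa using key q (by simpa using hq)
  have h2 : HasFPowerSeriesAt (fun _ : ℂ ↦ (1 : ℂ)) (FormalMultilinearSeries.ofScalars ℂ
      fun n ↦ (if n = 0 then 1 else 0 : ℂ)) 0 := by
    rw [hasFPowerSeriesAt_iff]
    filter_upwards with q
    refine (hasSum_ite_eq 0 (1 : ℂ)).congr_fun fun n ↦ ?_
    by_cases h : n = 0 <;> simp [h]
  have h3 := congrArg (fun p ↦ p.coeff n) (h1.eq_formalMultilinearSeries h2)
  simp only [FormalMultilinearSeries.coeff_ofScalars] at h3
  split_ifs at h3 ⊢ <;> exact_mod_cast h3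

end Gauss

section MinorArc

/-- Only the linear term of the Taylor series of `log ((1 + x) / (1 - x))` is kept exactly. -/
lemma norm_one_add_div_one_sub_le {x : ℂ} (hx : ‖x‖ < 1) :
    ‖(1 + x) / (1 - x)‖ ≤
      (1 + ‖x‖) / (1 - ‖x‖) * Real.exp (2 * (x.re - ‖x‖)) := by
  have hs : ∀ y : ℂ, ‖y‖ < 1 → HasSum (fun n : ℕ ↦ ((y ^ n - (-y) ^ n) / n).re)
      (Real.log ‖(1 + y) / (1 - y)‖) := by
    intro y hy
    have h1 := (Complex.hasSum_taylorSeries_neg_log hy).sub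
      (Complex.hasSum_taylorSeries_neg_log (z := -y) (by simpa using hy))
    have h2 := Complex.hasSum_re h1
    have n1 : 1 - y ≠ 0 := by simpa using one_sub_pow_ne_zero_of_norm_lt_one hy 0
    have n2 : 1 + y ≠ 0 := by simpa using one_add_pow_ne_zero_of_norm_lt_one hy 1
    have e : (-Complex.log (1 - y) - -Complex.log (1 - -y)).re =
        Real.log ‖(1 + y) / (1 - y)‖ := by
      rw [norm_div, Real.log_div (by simpa using n2) (by simpa using n1), sub_neg_eq_add 1 y]
      simp [Complex.log_re]
      ring
    rw [← e]
    refine h2.congr_fun fun n ↦ ?_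
    rw [sub_div]
  have hr : 0 < 1 - ‖x‖ := by linarith
  have hpos : 0 < (1 + ‖x‖) / (1 - ‖x‖) := by positivity
  have h1 := hs x hx
  have h2 := hs (‖x‖ : ℂ) (by simpa using hx)
  have hn : ‖(1 + (‖x‖ : ℂ)) / (1 - (‖x‖ : ℂ))‖ = (1 + ‖x‖) / (1 - ‖x‖) := by
    have : (1 + (‖x‖ : ℂ)) / (1 - (‖x‖ : ℂ)) = (((1 + ‖x‖) / (1 - ‖x‖) : ℝ) : ℂ) := by
      push_cast; rfl
    rw [this, Complex.norm_real, Real.norm_of_nonneg hpos.le]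
  rw [hn] at h2
  have h3 := le_hasSum (h2.sub h1) 1 fun n _ ↦ by
    rw [← Complex.sub_re, ← sub_div, Complex.div_natCast_re]
    refine div_nonneg ?_ n.cast_nonneg
    rcases Nat.even_or_odd n with he | ho
    · simp [he.neg_pow]
    · rw [ho.neg_pow, ho.neg_pow]
      have := (Complex.re_le_norm (x ^ n)).trans_eq (norm_pow x n)
      have e : ((‖x‖ : ℂ) ^ n).re = ‖x‖ ^ n := by
        rw [← Complex.ofReal_pow, Complex.ofReal_re]
      simp only [Complex.sub_re, Complex.neg_re, e]
      linarith
  simp only [pow_one, Nat.cast_one, div_one, Complex.sub_re, Complex.neg_re,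
    Complex.ofReal_re] at h3
  have hpos' : 0 < ‖(1 + x) / (1 - x)‖ := by
    rw [norm_pos_iff]
    exact div_ne_zero (by simpa using one_add_pow_ne_zero_of_norm_lt_one hx 1)
      (by simpa using one_sub_pow_ne_zero_of_norm_lt_one hx 0)
  rw [← Real.exp_log hpos', ← Real.exp_log hpos, ← Real.exp_add]
  exact Real.exp_le_exp.2 (by linarith)

/-- Bound for the generating function away from `q = 1`. -/
lemma norm_overGen_le {q : ℂ} (hq : ‖q‖ < 1) :
    ‖overGen q‖ ≤ (overGen ‖q‖).re *
      Real.exp (2 * ((q / (1 - q)).re - ‖q‖ / (1 - ‖q‖))) := by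
  have hg : ∀ y : ℂ, ‖y‖ < 1 →
      Tendsto (fun N ↦ ∑ k ∈ range N, y ^ (k + 1)) atTop (𝓝 (y / (1 - y))) := by
    intro y hy
    simp_rw [pow_succ', ← mul_sum, div_eq_mul_inv]
    exact (hasSum_geometric_of_norm_lt_one hy).tendsto_sum_nat.const_mul y
  have hq' : ‖(‖q‖ : ℂ)‖ < 1 := by simpa using hq
  have h1 := (tendsto_prod_overGen hq).norm
  have h2 := (Complex.continuous_re.tendsto _).comp (tendsto_prod_overGen hq')
  have h3 := (Complex.continuous_re.tendsto _).comp (hg q hq)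
  have h4 := (Complex.continuous_re.tendsto _).comp (hg _ hq')
  have e : ((‖q‖ : ℂ) / (1 - (‖q‖ : ℂ))).re = ‖q‖ / (1 - ‖q‖) := by
    have : (‖q‖ : ℂ) / (1 - (‖q‖ : ℂ)) = ((‖q‖ / (1 - ‖q‖) : ℝ) : ℂ) := by push_cast; rfl
    rw [this, Complex.ofReal_re]
  rw [e] at h4
  refine le_of_tendsto_of_tendsto' h1
    (h2.mul ((Real.continuous_exp.tendsto _).comp ((h3.sub h4).const_mul 2))) fun N ↦ ?_
  have e1 : (∏ k ∈ range N, (1 + (‖q‖ : ℂ) ^ (k + 1)) / (1 - (‖q‖ : ℂ) ^ (k + 1))).re =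
      ∏ k ∈ range N, (1 + ‖q‖ ^ (k + 1)) / (1 - ‖q‖ ^ (k + 1)) := by
    rw [← Complex.ofReal_re (∏ k ∈ range N, (1 + ‖q‖ ^ (k + 1)) / (1 - ‖q‖ ^ (k + 1)))]
    push_cast
    rfl
  have e2 : (∑ k ∈ range N, (‖q‖ : ℂ) ^ (k + 1)).re = ∑ k ∈ range N, ‖q‖ ^ (k + 1) := by
    rw [← Complex.ofReal_re (∑ k ∈ range N, ‖q‖ ^ (k + 1))]
    push_cast
    rfl
  simp only [Function.comp_apply, e1, e2]
  rw [Complex.re_sum, ← sum_sub_distrib, mul_sum, Real.exp_sum, ← prod_mul_distrib, norm_prod]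
  refine prod_le_prod (fun _ _ ↦ norm_nonneg _) fun k _ ↦ ?_
  have hk : ‖q ^ (k + 1)‖ < 1 := by
    rw [norm_pow]; exact pow_lt_one₀ (norm_nonneg q) hq k.succ_ne_zero
  simpa [norm_pow] using norm_one_add_div_one_sub_le hk

end MinorArc

section Theta

/-- The series `∑ exp (-π k (k + 1) / z)` occurring in the transformation of the generating
function of overpartitions. -/
noncomputable def thetaDual (z : ℂ) : ℂ := ∑' k : ℕ, Complex.exp (-π * (k * (k + 1)) / z)

lemma norm_cexp_neg_pi_mul_lt_one {z : ℂ} (hz : 0 < z.re) : ‖Complex.exp (-π * z)‖ < 1 := by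
  rw [Complex.norm_exp, exp_lt_one_iff]
  have : (-(π : ℂ) * z).re = -π * z.re := by simp
  rw [this]
  nlinarith [pi_pos]

lemma tsum_thetaSign_eq_jacobiTheta₂ {z : ℂ} (hz : 0 < z.re) :
    ∑' j : ℕ, (thetaSign j : ℂ) * Complex.exp (-π * z) ^ (j ^ 2) =
      jacobiTheta₂ (1 / 2) (Complex.I * z) := by
  have hτ : 0 < (Complex.I * z).im := by simpa using hz
  have h := (hasSum_jacobiTheta₂_term (1 / 2) hτ).nat_add_neg
  have key : ∀ n : ℕ, jacobiTheta₂_term n (1 / 2) (Complex.I * z) +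
      jacobiTheta₂_term (-n) (1 / 2) (Complex.I * z) =
      2 * ((-1) ^ n * Complex.exp (-π * z) ^ (n ^ 2)) := by
    intro n
    have e1 : (-1 : ℂ) ^ n = Complex.exp (n * (π * Complex.I)) := by
      rw [Complex.exp_nat_mul, Complex.exp_pi_mul_I]
    have e2 : (-1 : ℂ) ^ n = Complex.exp (n * (-(π * Complex.I))) := by
      rw [Complex.exp_nat_mul, Complex.exp_neg, Complex.exp_pi_mul_I, inv_neg_one]
    rw [two_mul]
    congr 1
    · rw [e1, ← Complex.exp_nat_mul, ← Complex.exp_add, jacobiTheta₂_term]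
      congr 1
      push_cast
      linear_combination (π * n ^ 2 * z) * Complex.I_mul_I
    · rw [e2, ← Complex.exp_nat_mul, ← Complex.exp_add, jacobiTheta₂_term]
      congr 1
      push_cast
      linear_combination (π * n ^ 2 * z) * Complex.I_mul_I
  have h0 : jacobiTheta₂_term 0 (1 / 2) (Complex.I * z) = 1 := by simp [jacobiTheta₂_term]
  rw [h0] at h
  have h' := h.sub (hasSum_ite_eq (0 : ℕ) (1 : ℂ))
  rw [add_sub_cancel_right] at h'
  rw [← h'.tsum_eq]
  refine tsum_congr fun j ↦ ?_
  rw [key]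
  unfold thetaSign
  split_ifs with hj
  · simp [hj]; norm_num
  · push_cast; ring

lemma hasSum_thetaDual_term {z : ℂ} (hz : 0 < z.re) :
    HasSum (fun k : ℕ ↦ 2 * Complex.exp (-π * (k * (k + 1)) / z))
      (jacobiTheta₂ (Complex.I / (2 * z)) (Complex.I / z)) := by
  have hz0 : z ≠ 0 := by rintro rfl; simp at hz
  have hτ : 0 < (Complex.I / z).im := by
    rw [Complex.div_im]
    have := Complex.normSq_pos.2 hz0
    simp
    positivity
  refine (hasSum_jacobiTheta₂_term (Complex.I / (2 * z)) hτ).nat_add_neg_add_one.congr_fun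
    fun k ↦ ?_
  rw [two_mul]
  congr 1
  all_goals
    rw [jacobiTheta₂_term]
    congr 1
    push_cast
    field_simp
  · linear_combination (-((k : ℂ) * (k + 1))) * Complex.I_sq
  · linear_combination (-(k : ℂ)) * Complex.I_sq

lemma summable_thetaDual {z : ℂ} (hz : 0 < z.re) :
    Summable fun k : ℕ ↦ Complex.exp (-π * (k * (k + 1)) / z) := by
  have := (hasSum_thetaDual_term hz).summable
  exact (summable_mul_left_iff (by norm_num)).1 this

lemma jacobiTheta₂_half_eq {z : ℂ} (hz : 0 < z.re) :
    jacobiTheta₂ (1 / 2) (Complex.I * z) =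
      2 * thetaDual z / (z ^ (1 / 2 : ℂ) * Complex.exp (π / (4 * z))) := by
  have hz0 : z ≠ 0 := by rintro rfl; simp at hz
  have h1 : -Complex.I * (Complex.I * z) = z := by linear_combination (-z) * Complex.I_mul_I
  have h2 : (1 / 2 : ℂ) / (Complex.I * z) = -(Complex.I / (2 * z)) := by
    field_simp
    linear_combination Complex.I_sq
  have h3 : -1 / (Complex.I * z) = Complex.I / z := by
    field_simp
    linear_combination -Complex.I_sq
  have h4 : -(π : ℂ) * Complex.I * (1 / 2) ^ 2 / (Complex.I * z) = -(π / (4 * z)) := by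
    field_simp
    norm_num
  rw [jacobiTheta₂_functional_equation, h1, h2, h3, h4, jacobiTheta₂_neg_left,
    ← (hasSum_thetaDual_term hz).tsum_eq, tsum_mul_left, Complex.exp_neg, thetaDual]
  field_simp

/-- The modular transformation of the generating function of overpartitions. -/
lemma overGen_mul_thetaDual {z : ℂ} (hz : 0 < z.re) :
    overGen (Complex.exp (-π * z)) * thetaDual z =
      z ^ (1 / 2 : ℂ) * Complex.exp (π / (4 * z)) / 2 := by
  have h := overGen_mul_theta (norm_cexp_neg_pi_mul_lt_one hz)
  have hz0 : z ≠ 0 := by rintro rfl; simp at hz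
  rw [tsum_thetaSign_eq_jacobiTheta₂ hz, jacobiTheta₂_half_eq hz] at h
  have : z ^ (1 / 2 : ℂ) ≠ 0 := by simp [hz0]
  field_simp at h ⊢
  linear_combination h

lemma overGen_eq_inv_jacobiTheta₂ {z : ℂ} (hz : 0 < z.re) :
    overGen (Complex.exp (-π * z)) = (jacobiTheta₂ (1 / 2) (Complex.I * z))⁻¹ := by
  have h := overGen_mul_theta (norm_cexp_neg_pi_mul_lt_one hz)
  rw [tsum_thetaSign_eq_jacobiTheta₂ hz] at h
  exact eq_inv_of_mul_eq_one_left h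

lemma jacobiTheta₂_half_ne_zero {z : ℂ} (hz : 0 < z.re) :
    jacobiTheta₂ (1 / 2) (Complex.I * z) ≠ 0 := by
  have h := overGen_mul_theta (norm_cexp_neg_pi_mul_lt_one hz)
  rw [tsum_thetaSign_eq_jacobiTheta₂ hz] at h
  exact right_ne_zero_of_mul_eq_one h

lemma differentiableAt_overGen_cexp {z : ℂ} (hz : 0 < z.re) :
    DifferentiableAt ℂ (fun w ↦ overGen (Complex.exp (-π * w))) z := by
  have hτ : 0 < (Complex.I * z).im := by simpa using hz
  have hev : (fun w ↦ overGen (Complex.exp (-π * w))) =ᶠ[𝓝 z]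
      fun w ↦ (jacobiTheta₂ (1 / 2) (Complex.I * w))⁻¹ := by
    filter_upwards [(isOpen_lt continuous_const Complex.continuous_re).mem_nhds hz] with w hw
    exact overGen_eq_inv_jacobiTheta₂ hw
  refine DifferentiableAt.congr_of_eventuallyEq ?_ hev
  refine DifferentiableAt.inv ?_ (jacobiTheta₂_half_ne_zero hz)
  exact (differentiableAt_jacobiTheta₂_snd (1 / 2) hτ).comp z (by fun_prop)

lemma norm_thetaDual_sub_one_le {z : ℂ} (hz : 0 < z.re) :
    ‖thetaDual z - 1‖ ≤ rexp (-2 * π * (z⁻¹).re) / (1 - rexp (-2 * π * (z⁻¹).re)) := by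
  set X := rexp (-2 * π * (z⁻¹).re) with hX
  have hz0 : z ≠ 0 := by rintro rfl; simp at hz
  have hre : 0 < (z⁻¹).re := by
    rw [Complex.inv_re]; have := Complex.normSq_pos.2 hz0; positivity
  have hX1 : X < 1 := by
    rw [hX, exp_lt_one_iff]; nlinarith [pi_pos]
  have hX0 : 0 < X := exp_pos _
  have h := (hasSum_nat_add_iff' 1).2 (summable_thetaDual hz).hasSum
  simp only [range_one, sum_singleton, CharP.cast_eq_zero, zero_mul, mul_zero, zero_div,
    Complex.exp_zero] at h
  have hg : HasSum (fun k : ℕ ↦ X * X ^ k) (X * (1 - X)⁻¹) :=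
    (hasSum_geometric_of_lt_one hX0.le hX1).mul_left X
  rw [div_eq_mul_inv, ← hg.tsum_eq, thetaDual, ← h.tsum_eq]
  refine tsum_of_norm_bounded hg.summable.hasSum fun k ↦ ?_
  rw [Complex.norm_exp, ← pow_succ', hX, ← Real.exp_nat_mul, exp_le_exp]
  have e : (-(π : ℂ) * (((k + 1 : ℕ) : ℂ) * (((k + 1 : ℕ) : ℂ) + 1)) / z).re =
      -(π * ((k + 1) * (k + 2)) * (z⁻¹).re) := by
    have : (-(π : ℂ) * (((k + 1 : ℕ) : ℂ) * (((k + 1 : ℕ) : ℂ) + 1)) / z) =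
      ((-(π * ((k + 1) * (k + 2))) : ℝ) : ℂ) * z⁻¹ := by push_cast; ring
    rw [this, Complex.re_ofReal_mul]; ring
  rw [e]
  push_cast
  have : 0 ≤ π * (z⁻¹).re * (k * (k + 1)) := by positivity
  nlinarith

lemma norm_inv_thetaDual_sub_one_le {z : ℂ} (hz : 0 < z.re)
    (hX : rexp (-2 * π * (z⁻¹).re) ≤ 1 / 4) :
    ‖(thetaDual z)⁻¹ - 1‖ ≤ 2 * rexp (-2 * π * (z⁻¹).re) := by
  have h := norm_thetaDual_sub_one_le hz
  set X := rexp (-2 * π * (z⁻¹).re)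
  have hX0 : 0 < X := exp_pos _
  have h1 : X / (1 - X) ≤ 1 / 3 := by rw [div_le_iff₀ (by linarith)]; linarith
  have h2 : 1 - X / (1 - X) ≤ ‖thetaDual z‖ := by
    have := norm_sub_norm_le (1 : ℂ) (1 - thetaDual z)
    rw [norm_sub_rev 1, norm_one, sub_sub_cancel] at this
    linarith
  have h3 : thetaDual z ≠ 0 := norm_pos_iff.1 (by linarith)
  have h4 : (thetaDual z)⁻¹ - 1 = -(thetaDual z - 1) / thetaDual z := by field_simp; ring
  rw [h4, norm_div, norm_neg, div_le_iff₀ (by linarith)]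
  have h5 : X / (1 - X) ≤ 2 * X * (1 - X / (1 - X)) := by
    have h6 : 0 < 1 - X := by linarith
    rw [one_sub_div h6.ne', ← mul_div_assoc, div_le_div_iff_of_pos_right h6]
    nlinarith
  calc _ ≤ _ := h
    _ ≤ _ := h5
    _ ≤ _ := by gcongr

lemma overGen_exp_re_le {t : ℝ} (ht : 0 < t) :
    (overGen ((rexp (-π * t) : ℝ) : ℂ)).re ≤ √t * rexp (π / (4 * t)) / 2 := by
  have h := overGen_mul_thetaDual (z := t) (by simpa using ht)
  have h1 : ((rexp (-π * t) : ℝ) : ℂ) = Complex.exp (-π * t) := by push_cast; rfl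
  have hs : Summable fun k : ℕ ↦ rexp (-π * (k * (k + 1)) / t) := by
    have := summable_thetaDual (z := t) (by simpa using ht)
    rw [← Complex.summable_ofReal]
    refine this.congr fun k ↦ ?_
    push_cast; rfl
  have h2 : thetaDual t = ((∑' k : ℕ, rexp (-π * (k * (k + 1)) / t) : ℝ) : ℂ) := by
    rw [thetaDual, Complex.ofReal_tsum]; push_cast; rfl
  have h3 : 1 ≤ ∑' k : ℕ, rexp (-π * (k * (k + 1)) / t) := by
    have := hs.le_tsum 0 (fun j _ ↦ (exp_pos _).le)
    simpa using this
  have h4 : (t : ℂ) ^ (1 / 2 : ℂ) = ((√t : ℝ) : ℂ) := by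
    rw [Real.sqrt_eq_rpow, Complex.ofReal_cpow ht.le]; push_cast; rfl
  rw [← h1, h2, h4] at h
  have h5 := congrArg Complex.re h
  rw [mul_comm, Complex.re_ofReal_mul] at h5
  have h6 : ((√t : ℝ) : ℂ) * Complex.exp (π / (4 * t)) / 2 =
      ((√t * rexp (π / (4 * t)) / 2 : ℝ) : ℂ) := by push_cast; rfl
  rw [h6, Complex.ofReal_re] at h5
  rw [← h5]
  have h7 : 0 < √t * rexp (π / (4 * t)) / 2 := by positivity
  have h8 : 0 < (overGen ((rexp (-π * t) : ℝ) : ℂ)).re := by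
    rw [← h5] at h7
    exact pos_of_mul_pos_right h7 (by linarith)
  nlinarith

end Theta

section Contour

/-- The integrand of the circle method. -/
noncomputable def circleF (n : ℕ) (z : ℂ) : ℂ :=
  overGen (Complex.exp (-π * z)) * Complex.exp (π * n * z)

lemma differentiableAt_circleF (n : ℕ) {z : ℂ} (hz : 0 < z.re) :
    DifferentiableAt ℂ (circleF n) z :=
  (differentiableAt_overGen_cexp hz).mul (by fun_prop)

lemma integral_cexp_int_mul (k : ℤ) :
    ∫ y : ℝ in (-1)..1, Complex.exp (π * k * Complex.I * y) = if k = 0 then 2 else 0 := by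
  split_ifs with hk
  · simp [hk]; norm_num
  · have hc : (π : ℂ) * k * Complex.I ≠ 0 := by simp [hk, pi_ne_zero]
    rw [integral_exp_mul_complex hc]
    have : Complex.exp (π * k * Complex.I * (1 : ℝ)) =
        Complex.exp (π * k * Complex.I * (-1 : ℝ)) := by
      rw [Complex.exp_eq_exp_iff_exists_int]
      exact ⟨k, by push_cast; ring⟩
    rw [this, sub_self, zero_div]

/-- Cauchy's formula for the overpartition numbers. -/
lemma integral_circleF (n : ℕ) {t : ℝ} (ht : 0 < t) :
    ∫ y : ℝ in (-1)..1, circleF n (t + y * Complex.I) = 2 * pbar n := by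
  have hr : ‖Complex.exp (-π * t)‖ < 1 := norm_cexp_neg_pi_mul_lt_one (by simpa using ht)
  have hterm : ∀ (m : ℕ) (y : ℝ), (pbar m : ℂ) * Complex.exp (-π * (t + y * Complex.I)) ^ m *
      Complex.exp (π * n * (t + y * Complex.I)) =
      pbar m * Complex.exp (π * ((n : ℤ) - m : ℤ) * t) *
        Complex.exp (π * ((n : ℤ) - m : ℤ) * Complex.I * y) := by
    intro m y
    rw [← Complex.exp_nat_mul, mul_assoc (pbar m : ℂ), mul_assoc (pbar m : ℂ), ← Complex.exp_add,
      ← Complex.exp_add]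
    congr 2
    push_cast
    ring
  have hs := summable_norm_pbar hr
  have h := intervalIntegral.hasSum_integral_of_dominated_convergence
    (a := -1) (b := 1) (μ := MeasureTheory.volume)
    (F := fun (m : ℕ) (y : ℝ) ↦ (pbar m : ℂ) * Complex.exp (-π * (t + y * Complex.I)) ^ m *
      Complex.exp (π * n * (t + y * Complex.I)))
    (f := fun y : ℝ ↦ circleF n (t + y * Complex.I))
    (fun m _ ↦ ‖(pbar m : ℂ) * Complex.exp (-π * t) ^ m‖ * rexp (π * n * t))
    (fun m ↦ by fun_prop)
    (fun m ↦ Eventually.of_forall fun y _ ↦ by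
      rw [norm_mul, norm_mul, norm_mul, norm_pow, norm_pow, Complex.norm_exp, Complex.norm_exp,
        Complex.norm_exp]
      simp)
    (Eventually.of_forall fun y _ ↦ hs.mul_right _)
    (by simp)
    (Eventually.of_forall fun y _ ↦ by
      refine HasSum.mul_right _ ?_
      exact (summable_norm_pbar (norm_cexp_neg_pi_mul_lt_one (by simpa using ht))).of_norm.hasSum)
  rw [← h.tsum_eq, tsum_eq_single n]
  · simp_rw [hterm, intervalIntegral.integral_const_mul, integral_cexp_int_mul]
    simp
    ring
  · intro m hm
    simp_rw [hterm, intervalIntegral.integral_const_mul, integral_cexp_int_mul]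
    rw [if_neg (by omega), mul_zero]

/-- Deformation of a vertical chord of the circle `|z| = s` to the arc it cuts off. -/
lemma integral_chord_eq_arc {f : ℂ → ℂ} (hf : ∀ z : ℂ, 0 < z.re → DifferentiableAt ℂ f z)
    {s : ℝ} (hs : 0 < s) :
    ∫ y : ℝ in (-(√3 * s / 2))..(√3 * s / 2), f ((s / 2 : ℝ) + y * Complex.I) =
      ∫ α : ℝ in (-(π / 3))..(π / 3),
        f (s * Complex.exp (α * Complex.I)) * (s * Complex.exp (α * Complex.I)) := by
  obtain ⟨g, hg⟩ : Complex.IsExactOn f (Metric.ball ((2 * s : ℝ) : ℂ) (2 * s)) := by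
    refine DifferentiableOn.isExactOn_ball fun z hz ↦ (hf z ?_).differentiableWithinAt
    rw [Metric.mem_ball, Complex.dist_eq] at hz
    have := (Complex.abs_re_le_norm _).trans_lt hz
    rw [abs_lt] at this
    simp at this
    linarith
  have hball : ∀ z : ℂ, z.re ^ 2 + z.im ^ 2 < 4 * s * z.re →
      z ∈ Metric.ball ((2 * s : ℝ) : ℂ) (2 * s) := by
    intro z hz
    rw [Metric.mem_ball, Complex.dist_eq, ← sq_lt_sq₀ (norm_nonneg _) (by positivity),
      Complex.sq_norm, Complex.normSq_apply]
    simp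
    nlinarith
  have h3 : √3 ^ 2 = 3 := Real.sq_sqrt (by norm_num)
  have hsq : 0 < √3 := by positivity
  have hcontf : ∀ z : ℂ, 0 < z.re → ContinuousAt f z := fun z hz ↦ (hf z hz).continuousAt
  have hb : -(√3 * s / 2) ≤ √3 * s / 2 := by have : 0 < √3 * s / 2 := by positivity
                                             linarith
  have hchord : ∫ y : ℝ in (-(√3 * s / 2))..(√3 * s / 2),
      f ((s / 2 : ℝ) + y * Complex.I) * Complex.I =
      g ((s / 2 : ℝ) + (√3 * s / 2 : ℝ) * Complex.I) -
        g ((s / 2 : ℝ) + (-(√3 * s / 2) : ℝ) * Complex.I) := by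
    refine intervalIntegral.integral_eq_sub_of_hasDerivAt
      (f := fun y : ℝ ↦ g ((s / 2 : ℝ) + y * Complex.I)) ?_ ?_
    · intro y hy
      rw [Set.uIcc_of_le hb, Set.mem_Icc, ← abs_le] at hy
      have hy2 : y ^ 2 ≤ (√3 * s / 2) ^ 2 := sq_le_sq.2 (by rwa [abs_of_nonneg (a := √3 * s / 2) (by positivity)])
      have hd := hg ((s / 2 : ℝ) + y * Complex.I) (hball _ (by simp; nlinarith))
      have hl : HasDerivAt (fun y : ℝ ↦ ((s / 2 : ℝ) : ℂ) + y * Complex.I) Complex.I y := by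
        simpa using ((hasDerivAt_id y).ofReal_comp.mul_const Complex.I).const_add
          ((s / 2 : ℝ) : ℂ)
      exact hd.comp y hl
    · refine ContinuousOn.intervalIntegrable fun y _ ↦ ContinuousAt.continuousWithinAt ?_
      refine ContinuousAt.mul ?_ continuousAt_const
      exact ContinuousAt.comp (f := fun y : ℝ ↦ ((s / 2 : ℝ) : ℂ) + y * Complex.I)
        (hcontf _ (by simp; positivity)) (by fun_prop)
  have harc : ∫ α : ℝ in (-(π / 3))..(π / 3),
      f (s * Complex.exp (α * Complex.I)) * (s * Complex.exp (α * Complex.I) * Complex.I) =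
      g (s * Complex.exp ((π / 3 : ℝ) * Complex.I)) -
        g (s * Complex.exp ((-(π / 3) : ℝ) * Complex.I)) := by
    have hcos : ∀ α ∈ Set.uIcc (-(π / 3)) (π / 3), 1 / 2 ≤ cos α := by
      intro α hα
      rw [Set.uIcc_of_le (by linarith [pi_pos]), Set.mem_Icc, ← abs_le] at hα
      rw [← cos_pi_div_three, ← cos_abs α]
      exact cos_le_cos_of_nonneg_of_le_pi (abs_nonneg _) (by linarith [pi_pos]) hα
    refine intervalIntegral.integral_eq_sub_of_hasDerivAt
      (f := fun α : ℝ ↦ g (s * Complex.exp (α * Complex.I))) ?_ ?_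
    · intro α hα
      have hc := hcos α hα
      have hd := hg (s * Complex.exp (α * Complex.I)) (hball _ (by
        rw [Complex.re_ofReal_mul, Complex.im_ofReal_mul, Complex.exp_ofReal_mul_I_re,
          Complex.exp_ofReal_mul_I_im]
        nlinarith [sin_sq_add_cos_sq α, mul_pos hs hs]))
      have hl : HasDerivAt (fun α : ℝ ↦ (s : ℂ) * Complex.exp (α * Complex.I))
          (s * Complex.exp (α * Complex.I) * Complex.I) α := by
        have := (((hasDerivAt_id α).ofReal_comp.mul_const Complex.I).cexp).const_mul (s : ℂ)
        simpa [mul_assoc] using this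
      exact hd.comp α hl
    · refine ContinuousOn.intervalIntegrable fun α hα ↦ ContinuousAt.continuousWithinAt ?_
      have hc := hcos α hα
      refine ContinuousAt.mul ?_ (by fun_prop)
      exact ContinuousAt.comp (f := fun α : ℝ ↦ (s : ℂ) * Complex.exp (α * Complex.I))
        (hcontf _ (by
          rw [Complex.re_ofReal_mul, Complex.exp_ofReal_mul_I_re]
          positivity)) (by fun_prop)
  have e1 : ((s / 2 : ℝ) : ℂ) + (√3 * s / 2 : ℝ) * Complex.I =
      s * Complex.exp ((π / 3 : ℝ) * Complex.I) := by
    rw [Complex.exp_mul_I, ← Complex.ofReal_cos, ← Complex.ofReal_sin, cos_pi_div_three,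
      sin_pi_div_three]
    push_cast
    ring
  have e2 : ((s / 2 : ℝ) : ℂ) + (-(√3 * s / 2) : ℝ) * Complex.I =
      s * Complex.exp ((-(π / 3) : ℝ) * Complex.I) := by
    rw [Complex.exp_mul_I, ← Complex.ofReal_cos, ← Complex.ofReal_sin, cos_neg, sin_neg,
      cos_pi_div_three, sin_pi_div_three]
    push_cast
    ring
  rw [e1, e2, ← harc, intervalIntegral.integral_mul_const] at hchord
  simp_rw [← mul_assoc] at hchord
  rw [intervalIntegral.integral_mul_const] at hchord
  simp_rw [← mul_assoc]
  exact mul_right_cancel₀ Complex.I_ne_zero hchord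

end Contour

section Gaussian

lemma integrable_sq_mul_exp_neg_mul_sq {a : ℝ} (ha : 0 < a) :
    MeasureTheory.Integrable fun t : ℝ ↦ t ^ 2 * rexp (-a * t ^ 2) := by
  have := integrable_rpow_mul_exp_neg_mul_sq ha (s := 2) (by norm_num)
  simpa using this

lemma integral_sq_mul_exp_neg_mul_sq {a : ℝ} (ha : 0 < a) :
    ∫ t : ℝ, t ^ 2 * rexp (-a * t ^ 2) = √(π / a) / (2 * a) := by
  have h1 := integrable_exp_neg_mul_sq ha
  have h2 := integrable_sq_mul_exp_neg_mul_sq ha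
  have h3 : ∀ t : ℝ, HasDerivAt (fun t : ℝ ↦ t * rexp (-a * t ^ 2))
      (rexp (-a * t ^ 2) - 2 * a * (t ^ 2 * rexp (-a * t ^ 2))) t := by
    intro t
    have := (hasDerivAt_id t).mul ((((hasDerivAt_id t).pow 2).const_mul (-a)).exp)
    refine this.congr_deriv ?_
    simp
    ring
  have h4 := MeasureTheory.integral_eq_zero_of_hasDerivAt_of_integrable h3
    (h1.sub (h2.const_mul (2 * a))) (integrable_mul_exp_neg_mul_sq ha)
  rw [MeasureTheory.integral_sub h1 (h2.const_mul (2 * a)), MeasureTheory.integral_const_mul,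
    integral_gaussian] at h4
  rw [eq_div_iff (by positivity)]
  linarith

lemma abs_integral_gaussian_sub_le {a : ℝ} (ha : 5 ≤ a) :
    |(∫ t : ℝ in (-(1 / 2))..(1 / 2), (1 - 4 * t ^ 2) * rexp (-a * t ^ 2)) -
      √(π / a) * (1 - 2 / a)| ≤ 3 * rexp (-a / 4) := by
  have ha0 : 0 < a := by linarith
  set f : ℝ → ℝ := fun t ↦ (1 - 4 * t ^ 2) * rexp (-a * t ^ 2) with hf
  have h1 := integrable_exp_neg_mul_sq ha0
  have h2 := integrable_sq_mul_exp_neg_mul_sq ha0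
  have hfe : f = fun t ↦ rexp (-a * t ^ 2) - 4 * (t ^ 2 * rexp (-a * t ^ 2)) := by
    funext t; simp only [hf]; ring
  have hfi : MeasureTheory.Integrable f := by
    rw [hfe]; exact h1.sub (h2.const_mul 4)
  have hint : ∫ t, f t = √(π / a) * (1 - 2 / a) := by
    rw [hfe, MeasureTheory.integral_sub h1 (h2.const_mul 4), MeasureTheory.integral_const_mul,
      integral_gaussian, integral_sq_mul_exp_neg_mul_sq ha0]
    field_simp
    ring
  have hsplit := MeasureTheory.integral_add_compl
    (measurableSet_Ioc (a := (-(1 / 2) : ℝ)) (b := 1 / 2)) hfi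
  rw [← intervalIntegral.integral_of_le (by norm_num), hint] at hsplit
  rw [← hsplit, sub_add_cancel_left, abs_neg]
  have hgi : MeasureTheory.Integrable fun t : ℝ ↦ rexp (1 / 4) * rexp (-a / 4) * rexp (-1 * t ^ 2) :=
    (integrable_exp_neg_mul_sq one_pos).const_mul _
  have hb := MeasureTheory.norm_integral_le_of_norm_le
    (μ := MeasureTheory.volume.restrict (Set.Ioc (-(1 / 2) : ℝ) (1 / 2))ᶜ) (f := f)
    hgi.integrableOn (by
      refine (MeasureTheory.ae_restrict_iff' measurableSet_Ioc.compl).2 (Eventually.of_forall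
        fun t ht ↦ ?_)
      have ht2 : 1 / 4 ≤ t ^ 2 := by
        rw [Set.mem_compl_iff, Set.mem_Ioc, not_and_or, not_lt, not_le] at ht
        rcases ht with h | h <;> nlinarith
      rw [Real.norm_eq_abs, hf, abs_mul, abs_of_pos (exp_pos _), ← exp_add, ← exp_add,
        abs_of_nonpos (by linarith)]
      have h5 : 4 * t ^ 2 ≤ rexp (4 * t ^ 2 - 1) := by
        have := add_one_le_exp (4 * t ^ 2 - 1); linarith
      calc _ ≤ rexp (4 * t ^ 2 - 1) * rexp (-a * t ^ 2) := by gcongr; linarith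
        _ = rexp (4 * t ^ 2 - 1 + -a * t ^ 2) := (exp_add _ _).symm
        _ ≤ _ := by rw [exp_le_exp]; nlinarith)
  have hb2 := MeasureTheory.setIntegral_le_integral (s := (Set.Ioc (-(1 / 2) : ℝ) (1 / 2))ᶜ) hgi
    (Eventually.of_forall fun t ↦ by positivity)
  have hg : ∫ t : ℝ, rexp (1 / 4) * rexp (-a / 4) * rexp (-1 * t ^ 2) =
      rexp (1 / 4) * rexp (-a / 4) * √π := by
    rw [MeasureTheory.integral_const_mul, integral_gaussian, div_one]
  rw [hg] at hb2
  have h6 : rexp (1 / 4) ≤ 1.3 := by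
    have := Real.exp_bound' (x := 1 / 4) (by norm_num) (by norm_num) (n := 3) (by norm_num)
    norm_num [sum_range_succ, Nat.factorial] at this
    linarith
  have h7 : √π ≤ 1.8 := by
    rw [Real.sqrt_le_left (by norm_num)]
    linarith [pi_lt_d2]
  rw [Real.norm_eq_abs] at hb
  have h8 : rexp (1 / 4) * √π ≤ 1.3 * 1.8 := by gcongr
  have h9 : 0 < rexp (-a / 4) := exp_pos _
  calc _ ≤ _ := hb
    _ ≤ _ := hb2
    _ = (rexp (1 / 4) * √π) * rexp (-a / 4) := by ring
    _ ≤ _ := by nlinarith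

/-- The central integral over the arc, after the substitution `t = sin (α / 2)`. -/
lemma integral_cos_mul_exp_cos (c : ℝ) :
    ∫ α : ℝ in (-(π / 3))..(π / 3), cos (3 * α / 2) * rexp (c * cos α) =
      2 * rexp c * ∫ t : ℝ in (-(1 / 2))..(1 / 2), (1 - 4 * t ^ 2) * rexp (-(2 * c) * t ^ 2) := by
  have h := intervalIntegral.integral_comp_mul_deriv (a := -(π / 3)) (b := π / 3)
    (f := fun α ↦ sin (α / 2)) (f' := fun α ↦ cos (α / 2) / 2)
    (g := fun t ↦ (1 - 4 * t ^ 2) * rexp (-(2 * c) * t ^ 2))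
    (fun α _ ↦ by
      have := ((hasDerivAt_id α).div_const 2).sin
      refine this.congr_deriv ?_
      simp only [id]; ring)
    (by fun_prop) (by fun_prop)
  have e1 : sin (π / 3 / 2) = 1 / 2 := by rw [← sin_pi_div_six]; congr 1; ring
  have e2 : sin (-(π / 3) / 2) = -(1 / 2) := by rw [← sin_pi_div_six, ← sin_neg]; congr 1; ring
  simp only [e1, e2] at h
  rw [← h, ← intervalIntegral.integral_const_mul]
  refine intervalIntegral.integral_congr fun α _ ↦ ?_
  have h1 : cos α = 1 - 2 * sin (α / 2) ^ 2 := by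
    have := cos_sq' (α / 2); have h2 := cos_two_mul (α / 2)
    rw [mul_div_cancel₀ _ two_ne_zero] at h2; linarith
  have h2 : cos (3 * α / 2) = cos (α / 2) * (1 - 4 * sin (α / 2) ^ 2) := by
    have := cos_three_mul (α / 2)
    rw [← mul_div_assoc] at this
    rw [this, sin_sq]; ring
  simp only [Function.comp]
  rw [h2, h1]
  have h3 : rexp (c * (1 - 2 * sin (α / 2) ^ 2)) = rexp c * rexp (-(2 * c) * sin (α / 2) ^ 2) := by
    rw [← exp_add]; congr 1; ring
  rw [h3]; ring

end Gaussian

section Arc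

lemma one_half_le_cos {α : ℝ} (hα : |α| ≤ π / 3) : 1 / 2 ≤ cos α := by
  rw [← cos_pi_div_three, ← cos_abs α]
  exact cos_le_cos_of_nonneg_of_le_pi (abs_nonneg _) (by linarith [pi_pos]) hα

lemma thetaDual_ne_zero {z : ℂ} (hz : 0 < z.re) : thetaDual z ≠ 0 := by
  intro h
  have h1 := jacobiTheta₂_half_ne_zero hz
  rw [jacobiTheta₂_half_eq hz, h] at h1
  simp at h1

lemma circleF_mul_self_arc {n : ℕ} {x : ℝ} (hx : 0 < x) (hn : (n : ℝ) = x ^ 2) {α : ℝ}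
    (hα : |α| ≤ π / 3) {z : ℂ} (hz : z = (1 / (2 * x) : ℝ) * Complex.exp (α * Complex.I)) :
    circleF n z * z = ((1 / (2 * x) * √(1 / (2 * x)) / 2 * rexp (π * x * cos α) : ℝ) : ℂ) *
      (Complex.exp ((3 * α / 2 : ℝ) * Complex.I) * (thetaDual z)⁻¹) := by
  have hcos := one_half_le_cos hα
  set s : ℝ := 1 / (2 * x) with hs
  have hs0 : 0 < s := by positivity
  have hre : 0 < z.re := by
    rw [hz, Complex.re_ofReal_mul, Complex.exp_ofReal_mul_I_re]
    positivity
  have hT := thetaDual_ne_zero hre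
  have h := overGen_mul_thetaDual hre
  have hov : overGen (Complex.exp (-π * z)) =
      z ^ (1 / 2 : ℂ) * Complex.exp (π / (4 * z)) / 2 * (thetaDual z)⁻¹ := by
    rw [← h, mul_assoc, mul_inv_cancel₀ hT, mul_one]
  have hαI := abs_le.1 hα
  have hlog : Complex.log z = (Real.log s : ℝ) + α * Complex.I := by
    rw [hz, Complex.log_ofReal_mul hs0 (Complex.exp_ne_zero _), Complex.log_exp]
    · simp; linarith [pi_pos]
    · simp; linarith [pi_pos]
  have hz0 : z ≠ 0 := by rintro rfl; simp at hre
  have hsq : z ^ (1 / 2 : ℂ) = (√s : ℝ) * Complex.exp ((α / 2 : ℝ) * Complex.I) := by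
    rw [Complex.cpow_def_of_ne_zero hz0, hlog, add_mul, Complex.exp_add]
    congr 1
    · rw [Real.sqrt_eq_rpow, Real.rpow_def_of_pos hs0]
      push_cast
      rfl
    · congr 1; push_cast; ring
  have hexp : Complex.exp (π / (4 * z)) * Complex.exp (π * n * z) =
      ((rexp (π * x * cos α) : ℝ) : ℂ) := by
    rw [← Complex.exp_add, Complex.ofReal_exp]
    congr 1
    have hn' : (n : ℂ) = (x : ℂ) ^ 2 := by
      rw [← Complex.ofReal_pow, ← hn]; simp
    have hinv : z⁻¹ = 2 * x * Complex.exp (-(α * Complex.I)) := by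
      rw [hz, mul_inv, Complex.exp_neg, hs]
      push_cast
      rw [one_div, inv_inv]
    have hx' : (x : ℂ) ≠ 0 := by exact_mod_cast hx.ne'
    have : (π : ℂ) / (4 * z) = π / 4 * z⁻¹ := by field_simp
    rw [this, hinv, hn', hz, hs]
    push_cast
    rw [Complex.cos]
    field_simp
    ring_nf
  have h3 : Complex.exp ((3 * α / 2 : ℝ) * Complex.I) =
      Complex.exp ((α / 2 : ℝ) * Complex.I) * Complex.exp (α * Complex.I) := by
    rw [← Complex.exp_add]; congr 1; push_cast; ring
  rw [circleF, hov, hsq, h3]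
  calc _ = (√s : ℝ) * Complex.exp ((α / 2 : ℝ) * Complex.I) / 2 * (thetaDual z)⁻¹ *
        (Complex.exp (π / (4 * z)) * Complex.exp (π * n * z)) * z := by ring
    _ = _ := by
      rw [hexp]
      nth_rewrite 2 [hz]
      push_cast
      ring

lemma abs_arc_integral_sub_le {n : ℕ} {x : ℝ} (hx : 1 ≤ x) (hn : (n : ℝ) = x ^ 2) :
    |(∫ α : ℝ in (-(π / 3))..(π / 3),
        circleF n ((1 / (2 * x) : ℝ) * Complex.exp (α * Complex.I)) *
          ((1 / (2 * x) : ℝ) * Complex.exp (α * Complex.I))).re -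
      1 / (2 * x) * √(1 / (2 * x)) / 2 *
        ∫ α : ℝ in (-(π / 3))..(π / 3), cos (3 * α / 2) * rexp (π * x * cos α)| ≤
      1 / (2 * x) * √(1 / (2 * x)) * (2 * π / 3) := by
  have hx0 : 0 < x := by linarith
  have hpi : -(π / 3) ≤ π / 3 := by linarith [pi_pos]
  set s : ℝ := 1 / (2 * x) with hs
  have hs0 : 0 < s := by positivity
  have hcosα : ∀ α ∈ Set.uIcc (-(π / 3)) (π / 3), |α| ≤ π / 3 := by
    intro α hα
    rwa [Set.uIcc_of_le hpi, Set.mem_Icc, ← abs_le] at hα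
  have hre : ∀ α ∈ Set.uIcc (-(π / 3)) (π / 3),
      0 < ((s : ℂ) * Complex.exp (α * Complex.I)).re := by
    intro α hα
    have := one_half_le_cos (hcosα α hα)
    rw [Complex.re_ofReal_mul, Complex.exp_ofReal_mul_I_re]
    positivity
  have hint : IntervalIntegrable (fun α : ℝ ↦ circleF n (s * Complex.exp (α * Complex.I)) *
      (s * Complex.exp (α * Complex.I))) MeasureTheory.volume (-(π / 3)) (π / 3) := by
    refine ContinuousOn.intervalIntegrable fun α hα ↦ ContinuousAt.continuousWithinAt ?_
    refine ContinuousAt.mul ?_ (by fun_prop)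
    exact ContinuousAt.comp (f := fun α : ℝ ↦ (s : ℂ) * Complex.exp (α * Complex.I))
      (differentiableAt_circleF n (hre α hα)).continuousAt (by fun_prop)
  have hcomm := Complex.reCLM.intervalIntegral_comp_comm hint
  simp only [Complex.reCLM_apply] at hcomm
  have hint' : IntervalIntegrable (fun α : ℝ ↦ (circleF n (s * Complex.exp (α * Complex.I)) *
      (s * Complex.exp (α * Complex.I))).re) MeasureTheory.volume (-(π / 3)) (π / 3) :=
    ⟨Complex.reCLM.integrable_comp hint.1, Complex.reCLM.integrable_comp hint.2⟩
  rw [← hcomm, ← intervalIntegral.integral_const_mul, ← intervalIntegral.integral_sub hint'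
    (by apply Continuous.intervalIntegrable; fun_prop), ← Real.norm_eq_abs]
  refine (intervalIntegral.norm_integral_le_of_norm_le_const (E := ℝ) (C := s * √s) fun α hα ↦ ?_).trans
    (le_of_eq ?_)
  · have hα' := Set.uIoc_subset_uIcc hα
    have hc := one_half_le_cos (hcosα α hα')
    rw [circleF_mul_self_arc hx0 hn (hcosα α hα') rfl, Complex.re_ofReal_mul]
    have hX := norm_inv_thetaDual_sub_one_le (hre α hα')
    have hinv : ((s * Complex.exp (α * Complex.I))⁻¹ : ℂ).re = 2 * x * cos α := by
      have : ((s * Complex.exp (α * Complex.I))⁻¹ : ℂ) =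
          ((2 * x : ℝ) : ℂ) * Complex.exp ((-α : ℝ) * Complex.I) := by
        rw [mul_inv, ← Complex.exp_neg, hs]
        push_cast
        rw [one_div, inv_inv, neg_mul]
      rw [this, Complex.re_ofReal_mul, Complex.exp_ofReal_mul_I_re, cos_neg]
    rw [hinv] at hX
    have hxc : 1 / 2 ≤ x * cos α := by nlinarith
    have hX4 : rexp (-2 * π * (2 * x * cos α)) ≤ 1 / 4 := by
      have h1 : rexp (-2 * π * (2 * x * cos α)) ≤ rexp (-(2 : ℝ)) := by
        rw [exp_le_exp]; nlinarith [pi_gt_three]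
      have h2 : rexp (-2 : ℝ) ≤ 1 / 4 := by
        have := exp_one_gt_d9
        have h3 : rexp 2 = rexp 1 * rexp 1 := by rw [← exp_add]; norm_num
        rw [exp_neg, h3]
        rw [inv_le_comm₀ (by positivity) (by norm_num)]
        nlinarith
      linarith
    have hX' := hX hX4
    set z : ℂ := (s : ℂ) * Complex.exp (α * Complex.I)
    have hcosre : cos (3 * α / 2) = (Complex.exp ((3 * α / 2 : ℝ) * Complex.I)).re :=
      (Complex.exp_ofReal_mul_I_re _).symm
    have hdiff : s * √s / 2 * rexp (π * x * cos α) *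
        (Complex.exp ((3 * α / 2 : ℝ) * Complex.I) * (thetaDual z)⁻¹).re -
        s * √s / 2 * (cos (3 * α / 2) * rexp (π * x * cos α)) =
        s * √s / 2 * (rexp (π * x * cos α) *
        (Complex.exp ((3 * α / 2 : ℝ) * Complex.I) * ((thetaDual z)⁻¹ - 1)).re) := by
      rw [hcosre, mul_sub, mul_one, Complex.sub_re]; ring
    rw [hdiff, Real.norm_eq_abs, abs_mul, abs_of_nonneg (a := s * √s / 2) (by positivity), abs_mul,
      abs_of_pos (exp_pos _)]
    have hb : |(Complex.exp ((3 * α / 2 : ℝ) * Complex.I) * ((thetaDual z)⁻¹ - 1)).re| ≤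
        2 * rexp (-2 * π * (2 * x * cos α)) := by
      refine (Complex.abs_re_le_norm _).trans ?_
      rw [norm_mul, Complex.norm_exp_ofReal_mul_I, one_mul]
      exact hX'
    have hfin : rexp (π * x * cos α) *
        |(Complex.exp ((3 * α / 2 : ℝ) * Complex.I) * ((thetaDual z)⁻¹ - 1)).re| ≤ 2 := by
      calc _ ≤ rexp (π * x * cos α) * (2 * rexp (-2 * π * (2 * x * cos α))) := by gcongr
        _ = 2 * rexp (π * x * cos α + -2 * π * (2 * x * cos α)) := by rw [exp_add]; ring
        _ ≤ 2 * 1 := by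
          gcongr
          rw [exp_le_one_iff]
          nlinarith [pi_gt_three]
        _ = 2 := by norm_num
    have : 0 ≤ s * √s / 2 := by positivity
    nlinarith
  · rw [abs_of_nonneg (by linarith)]; ring

end Arc

section MinorArcs

lemma re_div_one_sub_polar {r θ : ℝ} (h0 : 0 ≤ r) (h1 : r < 1) {q : ℂ}
    (hq : q = r * Complex.exp (θ * Complex.I)) :
    r / (1 - r) - (q / (1 - q)).re =
      r * (1 - cos θ) * (1 + r) / ((1 - r) * ((1 - r) ^ 2 + 2 * (r * (1 - cos θ)))) := by
  have hre : q.re = r * cos θ := by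
    rw [hq, Complex.re_ofReal_mul, Complex.exp_ofReal_mul_I_re]
  have him : q.im = r * sin θ := by
    rw [hq, Complex.im_ofReal_mul, Complex.exp_ofReal_mul_I_im]
  have hc := cos_le_one θ
  have hden : 0 < (1 - r) ^ 2 + 2 * (r * (1 - cos θ)) := by
    have : 0 < (1 - r) ^ 2 := by apply pow_pos; linarith
    have : 0 ≤ r * (1 - cos θ) := mul_nonneg h0 (by linarith)
    linarith
  have hn : Complex.normSq (1 - q) = (1 - r) ^ 2 + 2 * (r * (1 - cos θ)) := by
    rw [Complex.normSq_apply]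
    simp only [Complex.sub_re, Complex.sub_im, Complex.one_re, Complex.one_im, hre, him]
    linear_combination r ^ 2 * sin_sq_add_cos_sq θ
  have h2 : 1 - r ≠ 0 := by linarith
  rw [Complex.div_re, hn]
  simp only [Complex.sub_re, Complex.sub_im, Complex.one_re, Complex.one_im, hre, him]
  generalize hw : (1 - r) ^ 2 + 2 * (r * (1 - cos θ)) = w at hden
  field_simp
  rw [← hw]
  linear_combination (r ^ 2 * (1 - r)) * sin_sq_add_cos_sq θ

lemma one_sub_exp_bounds {h : ℝ} : 1 - rexp (-h) ≤ h ∧ 1 - h ≤ rexp (-h) := by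
  have := add_one_le_exp (-h)
  constructor <;> linarith

lemma minor_arc_gain {h θ : ℝ} (h0 : 0 < h) (h1 : h ≤ 1 / 20) (hθ : √3 * h ≤ |θ|)
    (hθ' : |θ| ≤ π) :
    0.705 / h ≤ rexp (-h) * (1 - cos θ) * (1 + rexp (-h)) /
      ((1 - rexp (-h)) * ((1 - rexp (-h)) ^ 2 + 2 * (rexp (-h) * (1 - cos θ)))) := by
  have h3 : √3 ^ 2 = 3 := Real.sq_sqrt (by norm_num)
  have h3' : √3 ≤ 2 := by rw [Real.sqrt_le_left (by norm_num)]; norm_num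
  have hcos : cos θ ≤ cos (√3 * h) := by
    rw [← cos_abs θ]
    exact cos_le_cos_of_nonneg_of_le_pi (by positivity) hθ' hθ
  have hb := Real.cos_bound (x := √3 * h) (by rw [abs_of_nonneg (by positivity)]; nlinarith)
  rw [abs_of_nonneg (a := √3 * h) (by positivity)] at hb
  have hb' := (abs_le.1 hb).2
  have e4 : (√3 * h) ^ 4 = 9 * h ^ 4 := by
    rw [mul_pow, show √3 ^ 4 = (√3 ^ 2) ^ 2 by ring, h3]; norm_num
  rw [e4, mul_pow, h3] at hb'
  have hh : h ^ 2 ≤ 1 / 400 := by nlinarith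
  have hw : 1.498 * h ^ 2 ≤ 1 - cos θ := by
    have : h ^ 4 ≤ 1 / 400 * h ^ 2 := by nlinarith [sq_nonneg h]
    linarith [sq_nonneg h]
  obtain ⟨hr1, hr2⟩ := one_sub_exp_bounds (h := h)
  have hr3 : rexp (-h) < 1 := by rw [exp_lt_one_iff]; linarith
  set r := rexp (-h)
  have hv : 1.42 * h ^ 2 ≤ r * (1 - cos θ) := by
    calc 1.42 * h ^ 2 ≤ 0.95 * (1.498 * h ^ 2) := by nlinarith [sq_nonneg h]
      _ ≤ r * (1 - cos θ) := by
        apply mul_le_mul (by linarith) hw (by positivity) (by linarith)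
  set v := r * (1 - cos θ)
  have hd : 0 < 1 - r := by linarith
  set d := 1 - r with hdd
  have hv0 : 0 < v := by nlinarith
  have hr5 : 1.95 ≤ 1 + r := by linarith
  have hkey : d * (d ^ 2 + 2 * v) ≤ h * (h ^ 2 + 2 * v) := by gcongr
  calc 0.705 / h ≤ v * 1.95 / (h * (h ^ 2 + 2 * v)) := by
        rw [div_le_div_iff₀ h0 (by positivity)]
        nlinarith
    _ ≤ v * (1 + r) / (d * (d ^ 2 + 2 * v)) := by gcongr

lemma norm_circleF_minor_le {n : ℕ} {x y : ℝ} (hx : 16 ≤ x) (hn : (n : ℝ) = x ^ 2)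
    (hy : √3 * (1 / (2 * x)) / 2 ≤ |y|) (hy' : |y| ≤ 1) :
    ‖circleF n ((1 / (2 * x) / 2 : ℝ) + y * Complex.I)‖ ≤
      √(1 / (2 * x) / 2) / 2 * rexp (π * x - x) := by
  have hx0 : 0 < x := by linarith
  set t : ℝ := 1 / (2 * x) / 2 with ht
  have ht0 : 0 < t := by positivity
  have hπ := pi_pos
  have hq : ‖Complex.exp (-π * (t + y * Complex.I))‖ < 1 :=
    norm_cexp_neg_pi_mul_lt_one (by simpa using ht0)
  have hnorm : ‖Complex.exp (-π * (t + y * Complex.I))‖ = rexp (-π * t) := by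
    rw [Complex.norm_exp]; simp
  have hgen := norm_overGen_le hq
  rw [hnorm] at hgen
  have hreal := overGen_exp_re_le ht0
  have hpolar := re_div_one_sub_polar (r := rexp (-π * t)) (θ := -π * y) (exp_pos _).le
    (hnorm ▸ hq) (q := Complex.exp (-π * (t + y * Complex.I))) (by
      rw [Complex.ofReal_exp, ← Complex.exp_add]; congr 1; push_cast; ring)
  have hgain := minor_arc_gain (h := π * t) (θ := -π * y) (by positivity)
    (by
      rw [ht, div_div, mul_one_div, div_le_div_iff₀ (by positivity) (by norm_num)]
      nlinarith [pi_lt_d2])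
    (by
      rw [abs_mul, abs_neg, abs_of_pos hπ]
      have : √3 * (π * t) = π * (√3 * (1 / (2 * x)) / 2) := by rw [ht]; ring
      rw [this]; gcongr)
    (by rw [abs_mul, abs_neg, abs_of_pos hπ]; nlinarith)
  rw [← neg_mul] at hgain
  rw [← hpolar] at hgain
  have hsecond : ‖Complex.exp (π * n * (t + y * Complex.I))‖ = rexp (π * x / 4) := by
    rw [Complex.norm_exp]
    congr 1
    simp
    rw [hn, ht]; field_simp; norm_num
  have htx : π / (4 * t) = π * x := by rw [ht]; field_simp; norm_num
  rw [htx] at hreal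
  have hD : (π / 4 + 1) * x ≤ 2 * (rexp (-π * t) / (1 - rexp (-π * t)) -
      (Complex.exp (-π * (t + y * Complex.I)) / (1 - Complex.exp (-π * (t + y * Complex.I)))).re) := by
    have : (π / 4 + 1) * x ≤ 2 * (0.705 / (π * t)) := by
      rw [← mul_div_assoc, le_div_iff₀ (by positivity)]
      have : (π / 4 + 1) * x * (π * t) = (π / 4 + 1) * π / 4 := by rw [ht]; field_simp; norm_num
      rw [this]
      nlinarith [pi_lt_d2]
    linarith
  rw [circleF, norm_mul, hsecond]
  calc _ ≤ √t * rexp (π * x) / 2 * rexp (-((π / 4 + 1) * x)) * rexp (π * x / 4) := by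
        refine mul_le_mul_of_nonneg_right ?_ (exp_pos _).le
        refine hgen.trans (mul_le_mul hreal ?_ (exp_pos _).le (by positivity))
        rw [exp_le_exp]; linarith
    _ = √t / 2 * rexp (π * x + -((π / 4 + 1) * x) + π * x / 4) := by
        rw [exp_add, exp_add]; ring
    _ = _ := by congr 2; ring

lemma norm_integral_minor_le {n : ℕ} {x : ℝ} (hx : 16 ≤ x) (hn : (n : ℝ) = x ^ 2) :
    ‖(∫ y : ℝ in (-1)..1, circleF n ((1 / (2 * x) / 2 : ℝ) + y * Complex.I)) -
      ∫ y : ℝ in (-(√3 * (1 / (2 * x)) / 2))..(√3 * (1 / (2 * x)) / 2),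
        circleF n ((1 / (2 * x) / 2 : ℝ) + y * Complex.I)‖ ≤
      √(1 / (2 * x) / 2) * rexp (π * x - x) := by
  have hx0 : 0 < x := by linarith
  set b : ℝ := √3 * (1 / (2 * x)) / 2 with hb
  set C : ℝ := √(1 / (2 * x) / 2) / 2 * rexp (π * x - x) with hC
  have hb0 : 0 ≤ b := by positivity
  have hb1 : b ≤ 1 := by
    have h3' : √3 ≤ 2 := by rw [Real.sqrt_le_left (by norm_num)]; norm_num
    have : 1 / (2 * x) ≤ 1 := by rw [div_le_one (by positivity)]; linarith
    have h0 : 0 ≤ 1 / (2 * x) := by positivity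
    rw [hb]; nlinarith
  have hcont : Continuous fun y : ℝ ↦ circleF n ((1 / (2 * x) / 2 : ℝ) + y * Complex.I) := by
    rw [continuous_iff_continuousAt]
    intro y
    exact ContinuousAt.comp
      (f := fun y : ℝ ↦ (((1 / (2 * x) / 2 : ℝ) : ℂ) + y * Complex.I))
      (differentiableAt_circleF n (by
        simp only [Complex.add_re, Complex.ofReal_re, Complex.re_ofReal_mul, Complex.I_re, mul_zero,
          add_zero]
        positivity)).continuousAt (by fun_prop)
  have hii : ∀ u v : ℝ, IntervalIntegrable
      (fun y : ℝ ↦ circleF n ((1 / (2 * x) / 2 : ℝ) + y * Complex.I)) MeasureTheory.volume u v :=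
    fun u v ↦ hcont.intervalIntegrable u v
  rw [← intervalIntegral.integral_add_adjacent_intervals (hii (-1) (-b)) (hii (-b) 1),
    ← intervalIntegral.integral_add_adjacent_intervals (hii (-b) b) (hii b 1)]
  have h1 : ‖∫ y : ℝ in (-1)..(-b), circleF n ((1 / (2 * x) / 2 : ℝ) + y * Complex.I)‖ ≤
      C * |-b - -1| := by
    refine intervalIntegral.norm_integral_le_of_norm_le_const fun y hy ↦ ?_
    rw [Set.uIoc_of_le (by linarith), Set.mem_Ioc] at hy
    have hab : |y| = -y := abs_of_nonpos (by linarith)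
    exact norm_circleF_minor_le hx hn (by rw [hab]; linarith) (by rw [hab]; linarith)
  have h2 : ‖∫ y : ℝ in b..1, circleF n ((1 / (2 * x) / 2 : ℝ) + y * Complex.I)‖ ≤
      C * |1 - b| := by
    refine intervalIntegral.norm_integral_le_of_norm_le_const fun y hy ↦ ?_
    rw [Set.uIoc_of_le (by linarith), Set.mem_Ioc] at hy
    have hab : |y| = y := abs_of_nonneg (by linarith)
    exact norm_circleF_minor_le hx hn (by rw [hab]; linarith) (by rw [hab]; linarith)
  rw [abs_of_nonneg (by linarith)] at h1 h2
  have hC0 : 0 ≤ C := by positivity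
  have hCC : √(1 / (2 * x) / 2) * rexp (π * x - x) = 2 * C := by rw [hC]; ring
  rw [hCC]
  set A := ∫ y : ℝ in (-1)..(-b), circleF n ((1 / (2 * x) / 2 : ℝ) + y * Complex.I)
  set B := ∫ y : ℝ in (-b)..b, circleF n ((1 / (2 * x) / 2 : ℝ) + y * Complex.I)
  set D := ∫ y : ℝ in b..1, circleF n ((1 / (2 * x) / 2 : ℝ) + y * Complex.I)
  have : A + (B + D) - B = A + D := by ring
  rw [this]
  refine (norm_add_le A D).trans ?_
  nlinarith

end MinorArcs

section Asymptotics

/-- The main term of the Rademacher-type expansion of `pbar n`, as a function of `x = √n`. -/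
noncomputable def pbarMain (x : ℝ) : ℝ := rexp (π * x) / (8 * x ^ 2) * (1 - 1 / (π * x))

lemma abs_pbar_sub_main_le_exp {n : ℕ} {x : ℝ} (hx : 16 ≤ x) (hn : (n : ℝ) = x ^ 2) :
    |(pbar n : ℝ) - pbarMain x| ≤ 0.08 * rexp (π * x - x) := by
  have hx0 : 0 < x := by linarith
  have hπ := pi_gt_three
  have hminor := norm_integral_minor_le hx hn
  rw [integral_circleF n (by positivity : 0 < 1 / (2 * x) / 2),
    integral_chord_eq_arc (fun z hz ↦ differentiableAt_circleF n hz)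
      (by positivity : 0 < 1 / (2 * x))] at hminor
  have harc := abs_arc_integral_sub_le (by linarith) hn
  rw [integral_cos_mul_exp_cos (π * x)] at harc
  have hG := abs_integral_gaussian_sub_le (a := 2 * (π * x)) (by nlinarith)
  set A := ∫ α : ℝ in (-(π / 3))..(π / 3),
        circleF n ((1 / (2 * x) : ℝ) * Complex.exp (α * Complex.I)) *
          ((1 / (2 * x) : ℝ) * Complex.exp (α * Complex.I))
  set G := ∫ t : ℝ in (-(1 / 2))..(1 / 2), (1 - 4 * t ^ 2) * rexp (-(2 * (π * x)) * t ^ 2)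
  have hre := (Complex.abs_re_le_norm _).trans hminor
  have e1 : (2 * (pbar n : ℂ) - A).re = 2 * pbar n - A.re := by simp
  rw [e1] at hre
  have hsπ : π / (2 * (π * x)) = 1 / (2 * x) := by field_simp
  rw [hsπ] at hG
  set s : ℝ := 1 / (2 * x) with hs
  have hs0 : 0 < s := by positivity
  have hs1 : s ≤ 1 / 32 := by
    rw [hs]; apply one_div_le_one_div_of_le <;> linarith
  have hsq : √s ≤ 0.177 := by
    rw [Real.sqrt_le_left (by norm_num)]; norm_num; linarith
  have hsq2 : √(s / 2) ≤ 0.125 := by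
    rw [Real.sqrt_le_left (by norm_num)]; norm_num; linarith
  have hss : √s * √s = s := Real.mul_self_sqrt hs0.le
  set E := rexp (π * x - x) with hE
  have hE1 : 1 ≤ E := by rw [hE]; exact one_le_exp (by nlinarith)
  have hEG : rexp (π * x) * (3 * rexp (-(2 * (π * x)) / 4)) ≤ 3 * E := by
    have : rexp (π * x) * (3 * rexp (-(2 * (π * x)) / 4)) = 3 * rexp (π * x / 2) := by
      have : rexp (π * x) * rexp (-(2 * (π * x)) / 4) = rexp (π * x / 2) := by
        rw [← exp_add]; congr 1; ring
      linear_combination 3 * this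
    rw [this]
    rw [hE]
    gcongr
    nlinarith
  have hmain : s * √s / 2 * (2 * rexp (π * x) * (√s * (1 - 2 / (2 * (π * x))))) =
      2 * pbarMain x := by
    have : s * √s / 2 * (2 * rexp (π * x) * (√s * (1 - 2 / (2 * (π * x))))) =
      s * (√s * √s) * rexp (π * x) * (1 - 2 / (2 * (π * x))) := by ring
    rw [this, hss, hs, pbarMain]
    field_simp
    ring
  have hsss : s * √s ≤ 0.006 := by
    have : 0 ≤ √s := Real.sqrt_nonneg _
    nlinarith
  have hsss0 : 0 < s * √s := by positivity
  have h3 : |s * √s / 2 * (2 * rexp (π * x) * G) - 2 * pbarMain x| ≤ 0.006 * (3 * E) := by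
    rw [← hmain, ← mul_sub, ← mul_sub, abs_mul, abs_mul, abs_of_pos (by positivity),
      abs_of_pos (a := 2 * rexp (π * x)) (by positivity)]
    calc _ ≤ s * √s / 2 * (2 * rexp (π * x) * (3 * rexp (-(2 * (π * x)) / 4))) := by gcongr
      _ = s * √s * (rexp (π * x) * (3 * rexp (-(2 * (π * x)) / 4))) := by ring
      _ ≤ 0.006 * (3 * E) := by gcongr
  have h2 : s * √s * (2 * π / 3) ≤ 0.006 * (2.1 * E) := by
    have : 2 * π / 3 ≤ 2.1 * E := by linarith [pi_lt_d2]
    gcongr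
  have h1 : √(s / 2) * E ≤ 0.125 * E := by gcongr
  rw [abs_le] at *
  constructor <;> linarith

lemma pow_six_mul_exp_neg_le {x : ℝ} (hx : 16 ≤ x) : x ^ 6 * rexp (-x) ≤ 2 := by
  have h1 : x / 16 ≤ rexp (x / 16 - 1) := by
    have := add_one_le_exp (x / 16 - 1); linarith
  have h2 : (x / 16) ^ 16 ≤ rexp (x - 16) := by
    calc _ ≤ rexp (x / 16 - 1) ^ 16 := by gcongr
      _ = _ := by rw [← Real.exp_nat_mul]; congr 1; push_cast; ring
  have h3 : (x / 16) ^ 6 ≤ (x / 16) ^ 16 := pow_le_pow_right₀ (by linarith) (by norm_num)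
  have h4 : (16 : ℝ) ^ 6 ≤ 2 * rexp 16 := by
    have := exp_one_gt_d9
    have h5 : rexp 16 = rexp 1 ^ 16 := by rw [← Real.exp_nat_mul]; norm_num
    rw [h5]
    have : (2.718 : ℝ) ^ 16 ≤ rexp 1 ^ 16 := by gcongr; linarith
    norm_num at this ⊢
    linarith
  have h6 : rexp x = rexp (x - 16) * rexp 16 := by rw [← exp_add]; congr 1; ring
  rw [exp_neg, ← div_eq_mul_inv, div_le_iff₀ (exp_pos _), h6]
  have h7 : x ^ 6 = (x / 16) ^ 6 * 16 ^ 6 := by ring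
  rw [h7]
  have h8 : (x / 16) ^ 6 * 16 ^ 6 ≤ rexp (x - 16) * (2 * rexp 16) := by
    apply mul_le_mul (h3.trans h2) h4 (by positivity) (exp_pos _).le
  linarith

lemma abs_pbar_sub_main_le_of_large {n : ℕ} {x : ℝ} (hx : 16 ≤ x) (hn : (n : ℝ) = x ^ 2) :
    |(pbar n : ℝ) - pbarMain x| ≤ pbarMain x * (2 / x ^ 4) := by
  have hx0 : 0 < x := by linarith
  refine (abs_pbar_sub_main_le_exp hx hn).trans ?_
  have h := pow_six_mul_exp_neg_le hx
  have h1 : 0.97 ≤ 1 - 1 / (π * x) := by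
    have : 1 / (π * x) ≤ 1 / 48 := by
      apply one_div_le_one_div_of_le (by norm_num); nlinarith [pi_gt_three]
    linarith
  have h2 : rexp (π * x - x) = rexp (π * x) * rexp (-x) := by rw [← exp_add]; congr 1
  have h3 : pbarMain x * (2 / x ^ 4) = rexp (π * x) * (1 - 1 / (π * x)) / (4 * x ^ 6) := by
    rw [pbarMain]; field_simp; ring
  rw [h2, h3, le_div_iff₀ (by positivity)]
  calc _ = rexp (π * x) * (0.32 * (x ^ 6 * rexp (-x))) := by ring
    _ ≤ _ := by gcongr; linarith

end Asymptotics

section SmallCases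

/-- The integer `N! * S ^ N * ∑ i < N, (U / S) ^ i / i!`. -/
def expNum (N U S : ℕ) : ℕ := ∑ i ∈ range N, U ^ i * S ^ (N - i) * (N.factorial / i.factorial)

lemma cast_expNum (N U : ℕ) {S : ℕ} (hS : 0 < S) :
    (expNum N U S : ℝ) =
      S ^ N * N.factorial * ∑ i ∈ range N, ((U : ℝ) / S) ^ i / i.factorial := by
  rw [expNum, Nat.cast_sum, mul_sum]
  refine sum_congr rfl fun i hi ↦ ?_
  have hi' := (mem_range.1 hi).le
  have hS' : (S : ℝ) ≠ 0 := by exact_mod_cast hS.ne'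
  rw [Nat.cast_mul, Nat.cast_mul, Nat.cast_div (Nat.factorial_dvd_factorial hi')
    (by exact_mod_cast i.factorial_ne_zero), Nat.cast_pow, Nat.cast_pow, div_pow]
  have h : (S : ℝ) ^ N = S ^ (N - i) * S ^ i := by rw [← pow_add, Nat.sub_add_cancel hi']
  have h1 : (i.factorial : ℝ) ≠ 0 := by exact_mod_cast i.factorial_ne_zero
  rw [h]
  field_simp

lemma expNum_pow_le {N U S K : ℕ} (hS : 0 < S) {u : ℝ} (hu : (K * U : ℝ) / S ≤ u) :
    (expNum N U S : ℝ) ^ K ≤ (S ^ N * N.factorial) ^ K * rexp u := by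
  rw [cast_expNum N U hS, mul_pow]
  gcongr
  calc _ ≤ rexp (U / S) ^ K := by
        gcongr
        exact Real.sum_le_exp_of_nonneg (by positivity) N
    _ = rexp (K * U / S) := by rw [← Real.exp_nat_mul]; congr 1; ring
    _ ≤ rexp u := by gcongr

lemma le_expNum_pow {N V S K : ℕ} (hS : 0 < S) (hN : 0 < N) (hV : V ≤ S) {u : ℝ}
    (hu : u ≤ (K * V : ℝ) / S) :
    (S ^ N * N.factorial * N) ^ K * rexp u ≤
      ((expNum N V S * N + V ^ N * (N + 1) : ℕ) : ℝ) ^ K := by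
  have hS' : (0 : ℝ) < S := by exact_mod_cast hS
  have hN' : (0 : ℝ) < N := by exact_mod_cast hN
  have hb := Real.exp_bound' (x := (V : ℝ) / S) (by positivity)
    (by rw [div_le_one hS']; exact_mod_cast hV) hN
  have h1 : ((expNum N V S * N + V ^ N * (N + 1) : ℕ) : ℝ) = S ^ N * N.factorial * N *
      (∑ i ∈ range N, ((V : ℝ) / S) ^ i / i.factorial +
        ((V : ℝ) / S) ^ N * (N + 1) / (N.factorial * N)) := by
    push_cast
    rw [cast_expNum N V hS]
    have : (N.factorial : ℝ) ≠ 0 := by exact_mod_cast N.factorial_ne_zero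
    rw [div_pow (V : ℝ) S N]
    generalize ∑ i ∈ range N, ((V : ℝ) / S) ^ i / i.factorial = t
    field_simp
  rw [h1, mul_pow _ (_ + _) K]
  refine mul_le_mul_of_nonneg_left ?_ (by positivity : (0 : ℝ) ≤ (S ^ N * N.factorial * N) ^ K)
  calc rexp u ≤ rexp (K * V / S) := by gcongr
    _ = rexp (V / S) ^ K := by rw [← Real.exp_nat_mul]; congr 1; ring
    _ ≤ _ := pow_le_pow_left₀ (exp_pos _).le hb K

/-- An integer approximation to `π * √n / 64`, scaled by `10 ^ 10`. -/
def piSqrtApprox (n : ℕ) : ℕ :=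
  (fun x ↦ (x + n * (10 ^ 10 * 31415926535) ^ 2 / x) / 2)^[20] (10 ^ 24) / (64 * 10 ^ 10) - 1

/-- The decidable inequalities certifying that `p` is within a relative distance `2 / n ^ 2` of the
main term, where `U / S` and `V / S` are bounds for `π * √n / 64`. -/
def MainTermCert (n p U V S : ℕ) : Prop :=
  0 < S ∧ (64 * 10 ^ 10 * U) ^ 2 ≤ (S * 31415926535) ^ 2 * n ∧
  (S * 31415926536) ^ 2 * n ≤ (64 * 10 ^ 10 * V) ^ 2 ∧
  V ≤ S ∧ S < 64 * U ∧
  p * (8 * n) * n ^ 2 * (64 * U) * (S ^ 12 * Nat.factorial 12) ^ 64 +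
      expNum 12 U S ^ 64 * S * (n ^ 2 + 2) ≤ expNum 12 U S ^ 64 * (64 * U) * (n ^ 2 + 2) ∧
  (expNum 12 V S * 12 + V ^ 12 * (12 + 1)) ^ 64 * (64 * V) * n ^ 2 +
      (expNum 12 V S * 12 + V ^ 12 * (12 + 1)) ^ 64 * S * 2 ≤
    p * (8 * n) * n ^ 2 * (64 * V) * (S ^ 12 * Nat.factorial 12 * 12) ^ 64 +
      (expNum 12 V S * 12 + V ^ 12 * (12 + 1)) ^ 64 * (64 * V) * 2 +
      (expNum 12 V S * 12 + V ^ 12 * (12 + 1)) ^ 64 * S * n ^ 2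

instance (n p U V S : ℕ) : Decidable (MainTermCert n p U V S) := by
  unfold MainTermCert; infer_instance

lemma abs_sub_pbarMain_le {p n U V S q₁ q₂ P R x : ℝ} (hx : 0 < x) (hnx : n = x ^ 2)
    (hn : 2 ≤ n) (hS : 0 < S) (hU : S < 64 * U) (hq₁ : 0 < q₁) (hq₂ : 0 < q₂)
    (hlo : 64 * U ≤ π * x * S) (hhi : π * x * S ≤ 64 * V)
    (hP : P ≤ q₁ * rexp (π * x)) (hR : q₂ * rexp (π * x) ≤ R)
    (h₁ : p * (8 * n) * n ^ 2 * (64 * U) * q₁ + P * S * (n ^ 2 + 2) ≤ P * (64 * U) * (n ^ 2 + 2))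
    (h₂ : R * (64 * V) * n ^ 2 + R * S * 2 ≤
      p * (8 * n) * n ^ 2 * (64 * V) * q₂ + R * (64 * V) * 2 + R * S * n ^ 2) :
    |p - pbarMain x| ≤ pbarMain x * (2 / x ^ 4) := by
  have hπ := pi_pos
  have hE : 0 < rexp (π * x) := exp_pos _
  have hU0 : 0 < U := by linarith
  have hV0 : 0 < V := by linarith
  have hn0 : 0 < n := by linarith
  have hπx : 0 < π * x := by positivity
  have hup : p * (8 * n) * n ^ 2 ≤ rexp (π * x) * (1 - 1 / (π * x)) * (n ^ 2 + 2) := by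
    have e1 : p * (8 * n) * n ^ 2 * (64 * U) * q₁ ≤
        rexp (π * x) * ((64 * U - S) * (n ^ 2 + 2)) * q₁ := by
      calc _ ≤ P * ((64 * U - S) * (n ^ 2 + 2)) := by linarith
        _ ≤ q₁ * rexp (π * x) * ((64 * U - S) * (n ^ 2 + 2)) := by
          refine mul_le_mul_of_nonneg_right hP (mul_nonneg (by linarith) (by positivity))
        _ = _ := by ring
    have e2 := le_of_mul_le_mul_right e1 hq₁
    have e3 : (64 * U - S) ≤ (1 - 1 / (π * x)) * (64 * U) := by
      have : 64 * U / (π * x) ≤ S := by rw [div_le_iff₀ hπx]; linarith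
      have e : (1 - 1 / (π * x)) * (64 * U) = 64 * U - 64 * U / (π * x) := by ring
      rw [e]; linarith
    have e4 : p * (8 * n) * n ^ 2 * (64 * U) ≤
        rexp (π * x) * (1 - 1 / (π * x)) * (n ^ 2 + 2) * (64 * U) := by
      calc _ ≤ _ := e2
        _ ≤ rexp (π * x) * (((1 - 1 / (π * x)) * (64 * U)) * (n ^ 2 + 2)) := by gcongr
        _ = _ := by ring
    exact le_of_mul_le_mul_right e4 (by positivity)
  have hdn : rexp (π * x) * (1 - 1 / (π * x)) * (n ^ 2 - 2) ≤ p * (8 * n) * n ^ 2 := by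
    have hn2 : 0 ≤ n ^ 2 - 2 := by nlinarith
    have hVS : 0 ≤ 64 * V - S := by linarith
    have e1 : rexp (π * x) * ((64 * V - S) * (n ^ 2 - 2)) * q₂ ≤
        p * (8 * n) * n ^ 2 * (64 * V) * q₂ := by
      calc _ = q₂ * rexp (π * x) * ((64 * V - S) * (n ^ 2 - 2)) := by ring
        _ ≤ R * ((64 * V - S) * (n ^ 2 - 2)) :=
            mul_le_mul_of_nonneg_right hR (mul_nonneg hVS hn2)
        _ ≤ _ := by linarith
    have e2 := le_of_mul_le_mul_right e1 hq₂
    have e3 : (1 - 1 / (π * x)) * (64 * V) ≤ 64 * V - S := by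
      have : S ≤ 64 * V / (π * x) := by rw [le_div_iff₀ hπx]; linarith
      have e : (1 - 1 / (π * x)) * (64 * V) = 64 * V - 64 * V / (π * x) := by ring
      rw [e]; linarith
    have e4 : rexp (π * x) * (1 - 1 / (π * x)) * (n ^ 2 - 2) * (64 * V) ≤
        p * (8 * n) * n ^ 2 * (64 * V) := by
      calc _ = rexp (π * x) * (((1 - 1 / (π * x)) * (64 * V)) * (n ^ 2 - 2)) := by ring
        _ ≤ rexp (π * x) * ((64 * V - S) * (n ^ 2 - 2)) := by gcongr
        _ ≤ _ := e2
    exact le_of_mul_le_mul_right e4 (by positivity)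
  have hx4 : x ^ 4 = n ^ 2 := by rw [hnx]; ring
  rw [pbarMain, ← hnx, hx4, abs_le]
  have f1 : rexp (π * x) / (8 * n) * (1 - 1 / (π * x)) * (1 + 2 / n ^ 2) =
      rexp (π * x) * (1 - 1 / (π * x)) * (n ^ 2 + 2) / ((8 * n) * n ^ 2) := by
    generalize 1 - 1 / (π * x) = t
    field_simp
  have f2 : rexp (π * x) / (8 * n) * (1 - 1 / (π * x)) * (1 - 2 / n ^ 2) =
      rexp (π * x) * (1 - 1 / (π * x)) * (n ^ 2 - 2) / ((8 * n) * n ^ 2) := by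
    generalize 1 - 1 / (π * x) = t
    field_simp
  have g1 : p ≤ rexp (π * x) / (8 * n) * (1 - 1 / (π * x)) * (1 + 2 / n ^ 2) := by
    rw [f1, le_div_iff₀ (by positivity)]; linarith
  have g2 : rexp (π * x) / (8 * n) * (1 - 1 / (π * x)) * (1 - 2 / n ^ 2) ≤ p := by
    rw [f2, div_le_iff₀ (by positivity)]; linarith
  constructor <;> linarith

lemma scaled_le_pi_mul {n U S : ℕ} (h : (64 * 10 ^ 10 * U) ^ 2 ≤ (S * 31415926535) ^ 2 * n) {x : ℝ}
    (hx : 0 < x) (hnx : (n : ℝ) = x ^ 2) : 64 * U ≤ π * x * S := by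
  have h' : ((64 * 10 ^ 10 * U : ℝ)) ^ 2 ≤ (S * 31415926535 * x) ^ 2 := by
    rw [mul_pow _ x, ← hnx]; exact_mod_cast h
  have h2 := abs_le_of_sq_le_sq' h' (by positivity)
  have := mul_le_mul_of_nonneg_right pi_gt_d20.le (by positivity : (0 : ℝ) ≤ x * S)
  have hp : (0 : ℝ) ≤ x * S := by positivity
  linarith [h2.2]

lemma pi_mul_le_scaled {n V S : ℕ} (h : (S * 31415926536) ^ 2 * n ≤ (64 * 10 ^ 10 * V) ^ 2) {x : ℝ}
    (hx : 0 < x) (hnx : (n : ℝ) = x ^ 2) : π * x * S ≤ 64 * V := by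
  have h' : (S * 31415926536 * x) ^ 2 ≤ ((64 * 10 ^ 10 * V : ℝ)) ^ 2 := by
    rw [mul_pow _ x, ← hnx]; exact_mod_cast h
  have h2 := abs_le_of_sq_le_sq' h' (by positivity)
  have := mul_le_mul_of_nonneg_right pi_lt_d20.le (by positivity : (0 : ℝ) ≤ x * S)
  have hp : (0 : ℝ) ≤ x * S := by positivity
  linarith [h2.2]

lemma MainTermCert.abs_sub_le {n p U V S : ℕ} (hn : 2 ≤ n) (h : MainTermCert n p U V S) {x : ℝ}
    (hx : 0 < x) (hnx : (n : ℝ) = x ^ 2) :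
    |(p : ℝ) - pbarMain x| ≤ pbarMain x * (2 / x ^ 4) := by
  obtain ⟨hS, h1, h2, h3, h4, h5, h6⟩ := h
  have hS' : (0 : ℝ) < S := by exact_mod_cast hS
  have hlo := scaled_le_pi_mul h1 hx hnx
  have hhi := pi_mul_le_scaled h2 hx hnx
  have hP := expNum_pow_le (N := 12) (U := U) (K := 64) (u := π * x) hS
    (by rw [div_le_iff₀ hS']; exact_mod_cast hlo)
  have hR := le_expNum_pow (N := 12) (V := V) (K := 64) (u := π * x) hS (by norm_num) h3
    (by rw [le_div_iff₀ hS']; exact_mod_cast hhi)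
  have hfac : (0 : ℝ) < Nat.factorial 12 := by exact_mod_cast Nat.factorial_pos 12
  refine abs_sub_pbarMain_le hx hnx (by exact_mod_cast hn) hS' (by exact_mod_cast h4)
    (q₁ := ((S : ℝ) ^ 12 * Nat.factorial 12) ^ 64)
    (q₂ := ((S : ℝ) ^ 12 * Nat.factorial 12 * (12 : ℕ)) ^ 64) (by positivity) (by positivity)
    hlo hhi hP hR ?_ ?_
  · have := (Nat.cast_le (α := ℝ)).2 h5
    simp only [Nat.cast_add, Nat.cast_mul, Nat.cast_pow] at this
    exact this
  · have := (Nat.cast_le (α := ℝ)).2 h6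
    simp only [Nat.cast_add, Nat.cast_mul, Nat.cast_pow] at this ⊢
    exact this

/-- The value of `pbar L.length` predicted from the list `L` of the earlier values, in decreasing
order of the argument. -/
def pbarNext (L : List ℕ) : ℤ :=
  if L = [] then 1 else ∑ j ∈ range 16, 2 * (-1) ^ j * (L.getD ((j + 1) ^ 2 - 1) 0 : ℤ)

lemma pbar_eq_sum_squares {m K : ℕ} (hm : 0 < m) (hK : m < (K + 1) ^ 2) :
    (pbar m : ℤ) = ∑ j ∈ range K, 2 * (-1) ^ j *
      if (j + 1) ^ 2 ≤ m then (pbar (m - (j + 1) ^ 2) : ℤ) else 0 := by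
  have h := pbar_recurrence m
  rw [if_neg hm.ne', Finset.Nat.sum_antidiagonal_eq_sum_range_succ_mk, ← sum_range_reflect,
    sum_range_succ'] at h
  have h0 : thetaCoeff 0 = 1 := by simp [thetaCoeff, thetaSign]
  have e : ∀ k ∈ range m, (pbar (m + 1 - 1 - (k + 1)) : ℤ) *
      thetaCoeff (m - (m + 1 - 1 - (k + 1))) = pbar (m - (k + 1)) * thetaCoeff (k + 1) := by
    intro k hk
    have := mem_range.1 hk
    congr 2
    omega
  simp only at h
  rw [sum_congr rfl e] at h
  simp only [Nat.succ_eq_add_one, add_tsub_cancel_right, tsub_zero, tsub_self, h0,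
    mul_one] at h
  have hinj : Set.InjOn (fun j : ℕ ↦ (j + 1) ^ 2 - 1) (range K) := by
    intro a _ b _ hab
    simp only at hab
    have h1 : 1 ≤ (a + 1) ^ 2 := Nat.one_le_pow _ _ (by omega)
    have h2 : 1 ≤ (b + 1) ^ 2 := Nat.one_le_pow _ _ (by omega)
    have : (a + 1) ^ 2 = (b + 1) ^ 2 := by omega
    have := Nat.pow_left_injective (n := 2) (by norm_num) this
    omega
  have hs : ∑ k ∈ range m, (pbar (m - (k + 1)) : ℤ) * thetaCoeff (k + 1) =
      ∑ j ∈ range K, -(2 * (-1) ^ j *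
        if (j + 1) ^ 2 ≤ m then (pbar (m - (j + 1) ^ 2) : ℤ) else 0) := by
    rw [← sum_filter_of_ne (s := range K) (p := fun j ↦ (j + 1) ^ 2 ≤ m) (by
      intro j _ hj; by_contra hc; simp [hc] at hj)]
    refine (sum_subset (s₁ := ((range K).filter fun j ↦ (j + 1) ^ 2 ≤ m).image
      fun j ↦ (j + 1) ^ 2 - 1) (s₂ := range m) ?_ ?_).symm.trans ?_
    rotate_left 2
    · rw [sum_image (hinj.mono fun j hj ↦ (mem_filter.1 hj).1)]
      refine sum_congr rfl fun j hj ↦ ?_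
      rw [mem_filter] at hj
      have h1 : 1 ≤ (j + 1) ^ 2 := Nat.one_le_pow _ _ (by omega)
      rw [if_pos hj.2, Nat.sub_add_cancel h1]
      have : thetaCoeff ((j + 1) ^ 2) = 2 * (-1) ^ (j + 1) := by
        rw [thetaCoeff, Nat.sqrt_eq', if_pos rfl, thetaSign, if_neg (by omega)]
      rw [this]; ring
    · intro k hk
      rw [mem_image] at hk
      obtain ⟨j, hj, rfl⟩ := hk
      rw [mem_filter] at hj
      have h1 : 1 ≤ (j + 1) ^ 2 := Nat.one_le_pow _ _ (by omega)
      rw [mem_range]; omega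
    · intro k hk hk'
      have : thetaCoeff (k + 1) = 0 := by
        rw [thetaCoeff, if_neg]
        intro hsq
        apply hk'
        have hpos : 0 < (k + 1).sqrt := Nat.sqrt_pos.2 (by omega)
        have hr := mem_range.1 hk
        rw [mem_image]
        refine ⟨(k + 1).sqrt - 1, ?_, ?_⟩
        · rw [mem_filter, mem_range, Nat.sub_add_cancel hpos]
          refine ⟨?_, by omega⟩
          by_contra hc
          have : (K + 1) ^ 2 ≤ (k + 1).sqrt ^ 2 := Nat.pow_le_pow_left (by omega) 2
          omega
        · rw [Nat.sub_add_cancel hpos]; omega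
      rw [this, mul_zero]
  rw [hs, sum_neg_distrib] at h
  linarith

/-- Each entry of the list satisfies the recurrence and is close to the main term. -/
def PbarListCert : List ℕ → Prop
  | [] => True
  | x :: L => (x : ℤ) = pbarNext L ∧ (2 ≤ L.length → MainTermCert L.length x
      (piSqrtApprox L.length) (piSqrtApprox L.length + 3) (10 ^ 10)) ∧ PbarListCert L

instance : DecidablePred PbarListCert := fun L ↦ by
  induction L with
  | nil => exact inferInstanceAs (Decidable True)
  | cons x L ih => unfold PbarListCert; infer_instance

lemma PbarListCert.getD_eq {L : List ℕ} (hL : PbarListCert L) (hlen : L.length ≤ 256) (i : ℕ) :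
    L.getD i 0 = if i < L.length then pbar (L.length - 1 - i) else 0 := by
  induction L generalizing i with
  | nil => simp
  | cons x L ih =>
    obtain ⟨h1, -, h3⟩ := hL
    rw [List.length_cons] at hlen
    have ih' := ih h3 (by omega)
    cases i with
    | succ i =>
      rw [List.getD_cons_succ, ih' i, List.length_cons]
      simp only [add_lt_add_iff_right]
      congr 2
      omega
    | zero =>
      rw [List.getD_cons_zero, List.length_cons, if_pos (by omega)]
      simp only [add_tsub_cancel_right, tsub_zero]
      rcases eq_or_ne L [] with rfl | hne
      · have : pbar 0 = 1 := by
          have := pbar_recurrence 0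
          simp [thetaCoeff, thetaSign] at this
          exact this
        rw [pbarNext, if_pos rfl] at h1
        simp only [List.length_nil, this]
        exact_mod_cast h1
      · have hpos : 0 < L.length := List.length_pos_iff.2 hne
        have := pbar_eq_sum_squares (K := 16) hpos (by omega)
        zify
        rw [h1, pbarNext, if_neg hne, this]
        refine sum_congr rfl fun j _ ↦ ?_
        rw [ih']
        have h1 : 1 ≤ (j + 1) ^ 2 := Nat.one_le_pow _ _ (by omega)
        by_cases hc : (j + 1) ^ 2 ≤ L.length
        · rw [if_pos hc, if_pos (by omega)]
          congr 3
          omega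
        · rw [if_neg hc, if_neg (by omega)]; simp

lemma PbarListCert.mainTermCert {L : List ℕ} (hL : PbarListCert L) (hlen : L.length ≤ 256) {n : ℕ}
    (h2 : 2 ≤ n) (hn : n < L.length) :
    MainTermCert n (pbar n) (piSqrtApprox n) (piSqrtApprox n + 3) (10 ^ 10) := by
  induction L with
  | nil => simp at hn
  | cons x L ih =>
    have hx := hL.getD_eq hlen 0
    obtain ⟨-, hc, h3⟩ := hL
    rw [List.length_cons] at hlen hn
    rcases Nat.lt_succ_iff_lt_or_eq.1 hn with h | rfl
    · exact ih h3 (by omega) h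
    · rw [List.getD_cons_zero, List.length_cons, if_pos (by omega)] at hx
      simp only [add_tsub_cancel_right, tsub_zero] at hx
      rw [← hx]
      exact hc h2

/-- The values `pbar 255, …, pbar 0`. -/
def pbarTable : List ℕ :=
  [2944208962035366912, 2678523600935931712, 2436378125421922096, 2215724833805155520,
    2014690906803656552, 1831563744040092144, 1664777507631008592, 1512900775311002400,
    1374625213276181184, 1248755186069127792, 1134198227409020456, 1029956301936618552,
    935117793435696104, 848850160246517964, 770393203335342864, 699052896859482688,
    634195735098829440, 575243553337247008, 521668783696898832, 472990110078057464,
    428768489255978160, 388603507855774632, 352130047383714128, 319015231754369000,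
    288955633834141824, 261674719436822928, 236920508968036216, 214463438535830800,
    194094403835283320, 175622971485083296, 158875743754158098, 143694863775085968,
    129936649405518592, 117470344877447088, 106176980273654592, 95948329696619584,
    86685959754142176, 78300360683341640, 70710153074638688, 63841363745226272,
    57626764851470016, 52005270824875704, 46921388170987232, 42324713588049400,
    38169476244909000, 34414120408862368, 31020924936491440, 27955656435773416,
    25187253178662336, 22687537091866448, 20430951381022304, 18394321552125264,
    16556637785418336, 14898856791947064, 13403721443461584, 12055596613448604,
    10840319801510208, 9745065236536520, 8758220267042680, 7869272950148382, 7068709845164640,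
    6347923104308752, 5699126032023856, 5115276356715000, 4590006524957824, 4117560388598672,
    3692735710455232, 3310831964946560, 2967602956053552, 2659213817204208, 2382201996297856,
    2133441864187792, 1910112617087168, 1709669172781168, 1529815787230456, 1368482142600120,
    1223801680121592, 1094091971468128, 977836940888944, 873670767334568, 780363311169472,
    696806924140080, 622004514142696, 555058747957032, 495162285758520, 441588950966768,
    393685747760714, 350865646632400, 312601065713344, 278417982216776, 247890614400992,
    220636620012256, 196312762133784, 174610997928996, 155254949948736, 137996723398312,
    122614036186432, 108907631721248, 96698947207176, 85828012764352, 76151559051360,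
    67541313153568, 59882464420368, 53072283702200, 47018880988096, 41640087878408,
    36862452650024, 32620336821800, 28855103196344, 25514386342400, 22551437333408,
    19924535352374, 17596459510080, 15534014851856, 13707607117664, 12090861369040,
    10660280058504, 9394936553248, 8276200533408, 7287492023632, 6414061138688, 5642790927768,
    4962020948656, 4361389440400, 3831692188920, 3364756358672, 2953327738320, 2590970015844,
    2271974827520, 1991281453488, 1744405156880, 1527373256064, 1336668113328, 1169176315720,
    1022143389578, 893133458704, 779993324928, 680820496056, 593934736120, 517852764088,
    451265759280, 393019368160, 342095945312, 297598783424, 258738113600, 224818685744,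
    195228753672, 169430308704, 146950426888, 127373604792, 110334972512, 95514288824,
    82630629440, 71437689296, 61719632168, 53287424374, 45975596616, 39639387364, 34152223024,
    29403495400, 25296604096, 21747232288, 18681828016, 16036268736, 13754686896, 11788436936,
    10095188560, 8638130600, 7385271744, 6308827912, 5384685232, 4591929040, 3912432072,
    3330494096, 2832526306, 2406775976, 2043085952, 1732684304, 1468001248, 1242509544,
    1050585080, 887385864, 748746736, 631087500, 531333440, 446846288, 375364064, 314949200,
    263943576, 220929376, 184695456, 154208270, 128586560, 107079712, 89049096, 73951808,
    61326856, 50783272, 41989744, 34665872, 28574656, 23515936, 19320904, 15847400, 12975792,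
    10605564, 8652402, 7045624, 5726080, 4644368, 3759240, 3036328, 2447064, 1967696, 1578528,
    1263272, 1008448, 802936, 637592, 504886, 398640, 313808, 246256, 192612, 150144, 116624,
    90248, 69568, 53408, 40824, 31066, 23528, 17728, 13288, 9904, 7336, 5400, 3948, 2864, 2062,
    1472, 1040, 728, 504, 344, 232, 154, 100, 64, 40, 24, 14, 8, 4, 2, 1]

lemma pbarListCert_pbarTable : PbarListCert pbarTable := by
  decide +kernel

lemma abs_pbar_sub_main_le {n : ℕ} (hn : 2 ≤ n) :
    |(pbar n : ℝ) - pbarMain √n| ≤ pbarMain √n * (2 / √n ^ 4) := by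
  have hsq : (n : ℝ) = √n ^ 2 := (Real.sq_sqrt (by positivity)).symm
  have hlen : pbarTable.length = 256 := by decide +kernel
  rcases lt_or_ge n 256 with h | h
  · refine (pbarListCert_pbarTable.mainTermCert hlen.le hn (by omega)).abs_sub_le hn ?_ hsq
    exact Real.sqrt_pos.2 (by exact_mod_cast (by omega : 0 < n))
  · refine abs_pbar_sub_main_le_of_large ?_ hsq
    rw [Real.le_sqrt (by norm_num) (by positivity)]
    norm_num
    exact_mod_cast h

end SmallCases

section FinalBounds

/-- The approximation to `log (pbar n)` at `x = √n`. -/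
noncomputable def logMain (x : ℝ) : ℝ :=
  π * x - log (8 * x ^ 2) - (1 / (π * x) + (1 / (π * x)) ^ 2 / 2 + (1 / (π * x)) ^ 3 / 3)

lemma abs_log_one_sub_add_le {y : ℝ} (h0 : 0 ≤ y) (h1 : y ≤ 1 / 4) :
    |log (1 - y) + (y + y ^ 2 / 2 + y ^ 3 / 3)| ≤ 4 / 3 * y ^ 4 := by
  have h := abs_log_sub_add_sum_range_le (x := y) (by rw [abs_of_nonneg h0]; linarith) 3
  simp only [sum_range_succ, sum_range_zero, abs_of_nonneg h0] at h
  norm_num at h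
  have h2 : y ^ 4 / (1 - y) ≤ 4 / 3 * y ^ 4 := by
    rw [div_le_iff₀ (by linarith)]
    nlinarith [pow_nonneg h0 4]
  refine le_trans (le_of_eq ?_) (h.trans h2)
  congr 1
  ring

lemma log_pbar_bounds {n : ℕ} (hn : 2 ≤ n) :
    logMain √n - 5 / √n ^ 4 ≤ log (pbar n) ∧ log (pbar n) ≤ logMain √n + 3 / √n ^ 4 ∧
      1 ≤ pbar n := by
  have hab := abs_le.1 (abs_pbar_sub_main_le hn)
  have hsq : √n ^ 2 = (n : ℝ) := Real.sq_sqrt (by positivity)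
  have hn' : (2 : ℝ) ≤ n := by exact_mod_cast hn
  have hx : 0 < √(n : ℝ) := Real.sqrt_pos.2 (by linarith)
  generalize √(n : ℝ) = x at *
  have hπ := pi_gt_three
  have hx' : 1.4 ≤ x := by nlinarith
  have hπx : 4 ≤ π * x := by nlinarith
  set y := 1 / (π * x) with hy
  have hy0 : 0 < y := by positivity
  have hy1 : y ≤ 1 / 4 := by rw [hy]; gcongr
  have hx4 : 4 ≤ x ^ 4 := by nlinarith
  have hy4 : y ^ 4 ≤ 1 / 81 * (1 / x ^ 4) := by
    rw [hy, div_pow, one_pow, mul_pow, ← one_div_mul_one_div]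
    gcongr
    nlinarith [pow_pos (by linarith : (0 : ℝ) < π - 3) 2, sq_nonneg (π ^ 2 - 9)]
  have hlog := abs_le.1 (abs_log_one_sub_add_le hy0.le hy1)
  set t := 2 / x ^ 4 with ht
  have ht0 : 0 < t := by positivity
  have ht1 : t ≤ 1 / 2 := by rw [ht, div_le_iff₀ (by positivity)]; linarith
  have hmain : pbarMain x = rexp (π * x) / (8 * x ^ 2) * (1 - y) := rfl
  have hmpos : 0 < pbarMain x := by
    rw [hmain]; exact mul_pos (by positivity) (by linarith)
  have hlm : log (pbarMain x) = π * x - log (8 * x ^ 2) + log (1 - y) := by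
    rw [hmain, log_mul (by positivity) (by linarith), log_div (by positivity) (by positivity),
      log_exp]
  have hlo : pbarMain x * (1 - t) ≤ pbar n := by linarith [hab.1]
  have hhi : (pbar n : ℝ) ≤ pbarMain x * (1 + t) := by linarith [hab.2]
  have hp : 0 < (pbar n : ℝ) := (mul_pos hmpos (by linarith)).trans_le hlo
  have h1 := log_le_log (mul_pos hmpos (by linarith)) hlo
  have h2 := log_le_log hp hhi
  rw [log_mul hmpos.ne' (by linarith), hlm] at h1 h2
  have h3 : -(2 * t) ≤ log (1 - t) := by
    refine le_trans ?_ (one_sub_inv_le_log_of_pos (by linarith))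
    have : (1 - t)⁻¹ ≤ 1 + 2 * t := by
      rw [inv_le_iff_one_le_mul₀ (by linarith)]; nlinarith
    linarith
  have h4 : log (1 + t) ≤ t := by
    have := log_le_sub_one_of_pos (by linarith : 0 < 1 + t); linarith
  have e5 : 5 / x ^ 4 = 5 / 2 * t := by rw [ht]; ring
  have e3 : 3 / x ^ 4 = 3 / 2 * t := by rw [ht]; ring
  have e1 : 1 / x ^ 4 = 1 / 2 * t := by rw [ht]; ring
  rw [e1] at hy4
  rw [e5, e3, logMain, ← hy]
  refine ⟨by linarith [hlog.1], by linarith [hlog.2], ?_⟩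
  exact Nat.one_le_iff_ne_zero.2 (by exact_mod_cast hp.ne')

lemma natCast_rpow_half_odd (n k : ℕ) : (n : ℝ) ^ ((k : ℝ) / 2) = √n ^ k := by
  rw [Real.sqrt_eq_rpow, ← Real.rpow_natCast, ← Real.rpow_mul (by positivity)]
  congr 1
  ring

lemma bounds_eq_add_logMain {x c : ℝ} (hx : 0 < x) :
    1 + 2 * π / x ^ 5 - 2 * log (8 * x ^ 2) / (x ^ 2) ^ 3 - 2 / (π * x ^ 7)
      - 1 / (π ^ 2 * (x ^ 2) ^ 4) + (6 * π ^ 4 - 2) / (3 * π ^ 3 * x ^ 9) + c / (x ^ 2) ^ 5 =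
    1 + 2 * logMain x / x ^ 6 + 2 * π / x ^ 9 + c / x ^ 10 := by
  have hπ := pi_pos
  rw [logMain]
  generalize log (8 * x ^ 2) = l
  field_simp
  ring

lemma Uplus_eq {n : ℕ} (hn : 0 < n) :
    Uplus n = 1 + 2 * logMain √n / √n ^ 6 + 2 * π / √n ^ 9 + 140 / √n ^ 10 := by
  have h5 := natCast_rpow_half_odd n 5
  have h7 := natCast_rpow_half_odd n 7
  have h9 := natCast_rpow_half_odd n 9
  push_cast at h5 h7 h9
  have hsq : (n : ℝ) = √n ^ 2 := (Real.sq_sqrt (by positivity)).symm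
  rw [Uplus, h5, h7, h9, ← bounds_eq_add_logMain (Real.sqrt_pos.2 (by exact_mod_cast hn)), ← hsq]

lemma Lplus_eq {n : ℕ} (hn : 0 < n) :
    Lplus n = 1 + 2 * logMain √n / √n ^ 6 + 2 * π / √n ^ 9 + -(80 * log n) / √n ^ 10 := by
  have h5 := natCast_rpow_half_odd n 5
  have h7 := natCast_rpow_half_odd n 7
  have h9 := natCast_rpow_half_odd n 9
  push_cast at h5 h7 h9
  have hsq : (n : ℝ) = √n ^ 2 := (Real.sq_sqrt (by positivity)).symm
  rw [Lplus, h5, h7, h9, ← bounds_eq_add_logMain (Real.sqrt_pos.2 (by exact_mod_cast hn)), ← hsq,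
    neg_div, ← sub_eq_add_neg]

lemma exp_lt_of_le_logMain {x L : ℝ} (hx : √2 ≤ x) (hL0 : 0 ≤ L) (hL : L ≤ logMain x + 3 / x ^ 4) :
    rexp (L * (2 / (x ^ 2 * (x ^ 2 - 1) * (x ^ 2 + 1)))) <
      1 + 2 * logMain x / x ^ 6 + 2 * π / x ^ 9 + 140 / x ^ 10 := by
  have hπ := pi_gt_three
  have hπ' := pi_lt_d2
  have h2 : 0 < √(2 : ℝ) := by positivity
  have hx0 : 0 < x := h2.trans_le hx
  have hx2 : 2 ≤ x ^ 2 := by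
    have := pow_le_pow_left₀ h2.le hx 2
    rwa [Real.sq_sqrt (by norm_num)] at this
  have hx4 : 4 ≤ x ^ 4 := by nlinarith
  have h3x : 3 / x ^ 4 ≤ 3 / 4 := by gcongr
  have hlog : 2.75 ≤ log (8 * x ^ 2) := by
    have h16 : log 16 = 4 * log 2 := by
      rw [show (16 : ℝ) = 2 ^ 4 by norm_num, log_pow]; norm_num
    have := log_le_log (by norm_num) (by linarith : (16 : ℝ) ≤ 8 * x ^ 2)
    linarith [log_two_gt_d9]
  have hLπ : L ≤ π * x - 2 := by
    have : logMain x ≤ π * x - log (8 * x ^ 2) := by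
      rw [logMain]
      have : 0 ≤ 1 / (π * x) + (1 / (π * x)) ^ 2 / 2 + (1 / (π * x)) ^ 3 / 3 := by positivity
      linarith
    linarith
  have hd : 0 < x ^ 4 - 1 := by linarith
  set E := L * (2 / (x ^ 2 * (x ^ 2 - 1) * (x ^ 2 + 1))) with hE
  have hE' : E = 2 * L / (x ^ 2 * (x ^ 4 - 1)) := by
    rw [hE, show x ^ 2 * (x ^ 2 - 1) * (x ^ 2 + 1) = x ^ 2 * (x ^ 4 - 1) by ring]; ring
  have hE0 : 0 ≤ E := by rw [hE']; positivity
  have hE1 : E ≤ 1 := by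
    rw [hE', div_le_one (by positivity)]
    nlinarith [sq_nonneg (x - 1.05)]
  have hexp : rexp E ≤ 1 + E + E ^ 2 := by
    have := abs_le.1 (abs_exp_sub_one_sub_id_le (x := E) (by rwa [abs_of_nonneg hE0]))
    linarith [this.2]
  have hsplit : E = 2 * L / x ^ 6 + 2 * L / x ^ 10 + 2 * L / (x ^ 4 - 1) / x ^ 10 := by
    rw [hE']; field_simp; ring
  have b1 : 2 * L / x ^ 6 ≤ 2 * logMain x / x ^ 6 + 6 / x ^ 10 := by
    have : 2 * logMain x / x ^ 6 + 6 / x ^ 10 = 2 * (logMain x + 3 / x ^ 4) / x ^ 6 := by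
      field_simp
      ring
    rw [this]; gcongr
  have b2 : 2 * L / x ^ 10 ≤ 2 * π / x ^ 9 := by
    have : 2 * π / x ^ 9 = 2 * (π * x) / x ^ 10 := by field_simp
    rw [this]; gcongr; linarith
  have b3 : 2 * L / (x ^ 4 - 1) / x ^ 10 ≤ 4 / x ^ 10 := by
    gcongr
    rw [div_le_iff₀ hd]
    nlinarith [sq_nonneg (x - 1.05)]
  have b4 : E ^ 2 ≤ 72 / x ^ 10 := by
    have : E ≤ 2 * (3.15 * x) / (x ^ 2 * (3 / 4 * x ^ 4)) := by
      rw [hE']; gcongr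
      · nlinarith
      · linarith
    calc E ^ 2 ≤ (2 * (3.15 * x) / (x ^ 2 * (3 / 4 * x ^ 4))) ^ 2 := by gcongr
      _ = 70.56 / x ^ 10 := by field_simp; norm_num
      _ ≤ _ := by gcongr; norm_num
  have b5 : 6 / x ^ 10 + 4 / x ^ 10 + 72 / x ^ 10 < 140 / x ^ 10 := by
    rw [← add_div, ← add_div]; gcongr; norm_num
  linarith

lemma lt_exp_of_logMain_le {x L : ℝ} (hx : √2 ≤ x) (hL0 : 0 ≤ L) (hL : logMain x - 5 / x ^ 4 ≤ L) :
    1 + 2 * logMain x / x ^ 6 + 2 * π / x ^ 9 + -(80 * log (x ^ 2)) / x ^ 10 <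
      rexp (L * (2 / (x ^ 2 * (x ^ 2 - 1) * (x ^ 2 + 1)))) := by
  have hπ := pi_gt_three
  have h2 : 0 < √(2 : ℝ) := by positivity
  have hx0 : 0 < x := h2.trans_le hx
  have hx2 : 2 ≤ x ^ 2 := by
    have := pow_le_pow_left₀ h2.le hx 2
    rwa [Real.sq_sqrt (by norm_num)] at this
  have hx4 : 4 ≤ x ^ 4 := by nlinarith
  have h5x : 5 / x ^ 4 ≤ 5 / 4 := by gcongr
  have hd : 0 < x ^ 4 - 1 := by linarith
  have hlog2 := log_le_log (by norm_num) hx2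
  have hlog : log (8 * x ^ 2) = 3 * log 2 + log (x ^ 2) := by
    rw [log_mul (by norm_num) (by positivity), show (8 : ℝ) = 2 ^ 3 by norm_num, log_pow]
    norm_num
  have hπx : 1 ≤ π * x := by nlinarith
  have hM : π * x - log (8 * x ^ 2) - 2 ≤ logMain x := by
    rw [logMain]
    have h0 : 0 ≤ 1 / (π * x) := by positivity
    have h1 : 1 / (π * x) ≤ 1 := by rw [div_le_one (by positivity)]; exact hπx
    have := pow_le_one₀ (n := 2) h0 h1
    have := pow_le_one₀ (n := 3) h0 h1
    linarith
  set E := L * (2 / (x ^ 2 * (x ^ 2 - 1) * (x ^ 2 + 1))) with hE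
  have hE' : E = 2 * L / (x ^ 2 * (x ^ 4 - 1)) := by
    rw [hE, show x ^ 2 * (x ^ 2 - 1) * (x ^ 2 + 1) = x ^ 2 * (x ^ 4 - 1) by ring]; ring
  have hsplit : E = 2 * L / x ^ 6 + 2 * L / x ^ 10 + 2 * L / (x ^ 4 - 1) / x ^ 10 := by
    rw [hE']; field_simp; ring
  have b1 : 2 * logMain x / x ^ 6 - 10 / x ^ 10 ≤ 2 * L / x ^ 6 := by
    have : 2 * logMain x / x ^ 6 - 10 / x ^ 10 = 2 * (logMain x - 5 / x ^ 4) / x ^ 6 := by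
      field_simp
      ring
    rw [this]; gcongr
  have b2 : 2 * π / x ^ 9 - (2 * log (8 * x ^ 2) + 7) / x ^ 10 ≤ 2 * L / x ^ 10 := by
    have : 2 * π / x ^ 9 - (2 * log (8 * x ^ 2) + 7) / x ^ 10 =
        (2 * (π * x) - (2 * log (8 * x ^ 2) + 7)) / x ^ 10 := by field_simp
    rw [this]; gcongr; linarith
  have b3 : 0 ≤ 2 * L / (x ^ 4 - 1) / x ^ 10 := by positivity
  have b4 : -(80 * log (x ^ 2)) / x ^ 10 < -(10 / x ^ 10) - (2 * log (8 * x ^ 2) + 7) / x ^ 10 := by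
    rw [← neg_div, ← sub_div]
    gcongr
    linarith [log_two_gt_d9, log_two_lt_d9]
  linarith [add_one_le_exp E]

end FinalBounds

end Helpers

theorem stmt13 (n : ℕ) (hn : 2 ≤ n) :
    Lplus n < (pbar n : ℝ) ^ (2 / ((n : ℝ) * ((n : ℝ) - 1) * ((n : ℝ) + 1))) ∧
    (pbar n : ℝ) ^ (2 / ((n : ℝ) * ((n : ℝ) - 1) * ((n : ℝ) + 1))) < Uplus n := by
  obtain ⟨h1, h2, hp⟩ := log_pbar_bounds hn
  have hp' : (1 : ℝ) ≤ pbar n := by exact_mod_cast hp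
  have hL := log_nonneg hp'
  have hx : √2 ≤ √(n : ℝ) := Real.sqrt_le_sqrt (by exact_mod_cast hn)
  have hsq : √(n : ℝ) ^ 2 = n := Real.sq_sqrt (by positivity)
  rw [Real.rpow_def_of_pos (by linarith), Lplus_eq (by omega), Uplus_eq (by omega)]
  have hlo := lt_exp_of_logMain_le hx hL h1
  have hhi := exp_lt_of_le_logMain hx hL h2
  rw [hsq] at hlo hhi
  exact ⟨hlo, hhi⟩
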